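/- arXiv:0810.3881 — 4 statements merged into one kernel-verified Lean document; each statement's English description precedes it below -/
import Mathlib

section
/- Let X be a Banach space with an unconditional Schauder basis which admits a Lipschitz, C^p-smooth bump function. Let Y ⊆ X be a convex subset and f : Y → ℝ a uniformly continuous map. Then for each ε > 0 there exists a Lipschitz, C^p-smooth function K : X → ℝ such that |f(y) − K(y)| < ε for all y ∈ Y. -/
open Function Bornology

/-- `X` has an unconditional Schauder basis: every `x` has a unique expansion
`x = ∑ⱼ xⱼ eⱼ` converging unconditionally (unconditional convergence = `HasSum`). -/
def HasUnconditionalSchauderBasis (X : Type*) [NormedAddCommGroup X] [NormedSpace ℝ X] : Prop :=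
  ∃ e : ℕ → X, ∀ x : X, ∃! a : ℕ → ℝ, HasSum (fun j => a j • e j) x

/-- `X` admits a Lipschitz, `C^p`-smooth bump function: a `C^p`-smooth, Lipschitz
real-valued function with bounded, nonempty support. -/
def HasLipschitzSmoothBump (X : Type*) [NormedAddCommGroup X] [NormedSpace ℝ X] (p : ℕ∞) : Prop :=
  ∃ b : X → ℝ, ContDiff ℝ p b ∧ (∃ C : NNReal, LipschitzWith C b) ∧
    IsBounded (closure (support b)) ∧ (support b).Nonempty

open scoped ContDiff NNReal Topology

/-- A smooth, one-sided approximation `m` of the binary maximum, up to an error `δ`. -/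
structure IsSmoothMax (m : ℝ → ℝ → ℝ) (δ : ℝ) : Prop where
  contDiff : ContDiff ℝ ∞ (uncurry m)
  mono : ∀ ⦃a a' b b'⦄, a ≤ a' → b ≤ b' → m a b ≤ m a' b'
  add_const : ∀ a b c, m (a + c) (b + c) = m a b + c
  eq_left : ∀ ⦃a b⦄, b ≤ a → m a b = a
  sub_le : ∀ a b, b - δ ≤ m a b

namespace IsSmoothMax

variable {m : ℝ → ℝ → ℝ} {δ : ℝ}

lemma self (hm : IsSmoothMax m δ) (a : ℝ) : m a a = a := hm.eq_left le_rfl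

lemma le_of_le (hm : IsSmoothMax m δ) {a b c : ℝ} (ha : a ≤ c) (hb : b ≤ c) : m a b ≤ c :=
  (hm.mono ha hb).trans_eq (hm.self c)

lemma left_le (hm : IsSmoothMax m δ) (a b : ℝ) : a ≤ m a b := by
  rcases le_total b a with h | h
  · exact (hm.eq_left h).ge
  · calc a = m a a := (hm.self a).symm
      _ ≤ m a b := hm.mono le_rfl h

lemma comp_contDiff (hm : IsSmoothMax m δ) {X : Type*} [NormedAddCommGroup X] [NormedSpace ℝ X]
    {p : ℕ∞} {u v : X → ℝ} (hu : ContDiff ℝ p u) (hv : ContDiff ℝ p v) :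
    ContDiff ℝ p fun x => m (u x) (v x) :=
  (hm.contDiff.of_le (mod_cast le_top)).comp (hu.prodMk hv)

lemma comp_lipschitz (hm : IsSmoothMax m δ) {X : Type*} [PseudoMetricSpace X]
    {C : ℝ≥0} {u v : X → ℝ} (hu : LipschitzWith C u) (hv : LipschitzWith C v) :
    LipschitzWith C fun x => m (u x) (v x) := by
  refine LipschitzWith.of_le_add_mul C fun x y => ?_
  rw [← hm.add_const]
  exact hm.mono (hu.le_add_mul x y) (hv.le_add_mul x y)

end IsSmoothMax

/-- A smooth approximation of the positive part on `ℝ`. -/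
lemma exists_smooth_posPart : ∃ s : ℝ → ℝ, ContDiff ℝ ∞ s ∧ Monotone s ∧
    Antitone (fun t => s t - t) ∧ (∀ t ≤ 0, s t = 0) ∧ ∀ t, t - 1 ≤ s t := by
  have hcont : Continuous Real.smoothTransition := Real.smoothTransition.continuous
  have hint (a b : ℝ) : IntervalIntegrable Real.smoothTransition MeasureTheory.volume a b :=
    hcont.intervalIntegrable a b
  set s : ℝ → ℝ := fun t => ∫ u in (0 : ℝ)..t, Real.smoothTransition u with hs
  have hd (t : ℝ) : HasDerivAt s (Real.smoothTransition t) t :=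
    intervalIntegral.integral_hasDerivAt_right (hint 0 t)
      (hcont.stronglyMeasurableAtFilter _ _) hcont.continuousAt
  have hderiv : deriv s = Real.smoothTransition := funext fun t => (hd t).deriv
  have hdiff : Differentiable ℝ s := fun t => (hd t).differentiableAt
  have hmono : Monotone s := monotone_of_deriv_nonneg hdiff fun t => by
    rw [hderiv]; exact Real.smoothTransition.nonneg t
  have hzero (t : ℝ) (ht : t ≤ 0) : s t = 0 := by
    rw [hs]
    refine (intervalIntegral.integral_congr (g := fun _ => (0 : ℝ)) fun u hu => ?_).trans (by simp)
    rw [Set.uIcc_of_ge ht] at hu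
    exact Real.smoothTransition.zero_of_nonpos hu.2
  have hnonneg (t : ℝ) : 0 ≤ s t := by
    rcases le_total t 0 with h | h
    · exact (hzero t h).ge
    · exact (hzero 0 le_rfl).ge.trans (hmono h)
  refine ⟨s, ?_, hmono, ?_, hzero, fun t => ?_⟩
  · rw [contDiff_infty_iff_deriv, hderiv]
    exact ⟨hdiff, Real.smoothTransition.contDiff⟩
  · refine antitone_of_deriv_nonpos (hdiff.sub differentiable_id) fun t => ?_
    have hdt : HasDerivAt (fun t => s t - t) (Real.smoothTransition t - 1) t :=
      (hd t).sub (hasDerivAt_id t)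
    rw [hdt.deriv]
    linarith [Real.smoothTransition.le_one t]
  · rcases le_total t 1 with h | h
    · linarith [hnonneg t]
    · have h1 : s t = s 1 + ∫ u in (1 : ℝ)..t, Real.smoothTransition u :=
        (intervalIntegral.integral_add_adjacent_intervals (hint 0 1) (hint 1 t)).symm
      have h2 : ∫ u in (1 : ℝ)..t, Real.smoothTransition u = t - 1 := by
        refine (intervalIntegral.integral_congr (g := fun _ => (1 : ℝ)) fun u hu => ?_).trans
          (by simp)
        rw [Set.uIcc_of_le h] at hu
        exact Real.smoothTransition.one_of_one_le hu.1
      linarith [hnonneg 1]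

lemma exists_isSmoothMax {δ : ℝ} (hδ : 0 < δ) : ∃ m, IsSmoothMax m δ := by
  obtain ⟨s, hs, hmono, hanti, hzero, hle⟩ := exists_smooth_posPart
  have hdiv {a b : ℝ} (h : a ≤ b) : a / δ ≤ b / δ := div_le_div_of_nonneg_right h hδ.le
  refine ⟨fun a b => a + δ * s ((b - a) / δ), ?_, ?_, ?_, ?_, ?_⟩
  · have : ContDiff ℝ ∞ fun q : ℝ × ℝ => q.1 + δ * s ((q.2 - q.1) / δ) :=
      contDiff_fst.add (contDiff_const.mul
        (hs.comp ((contDiff_snd.sub contDiff_fst).div_const δ)))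
    exact this
  · intro a a' b b' ha hb
    have h1 : s ((b - a) / δ) ≤ s ((b' - a) / δ) := hmono (hdiv (by linarith))
    have h2 : s ((b' - a) / δ) - (b' - a) / δ ≤ s ((b' - a') / δ) - (b' - a') / δ :=
      hanti (hdiv (by linarith))
    have h3 : δ * ((b' - a) / δ) = b' - a := mul_div_cancel₀ _ hδ.ne'
    have h4 : δ * ((b' - a') / δ) = b' - a' := mul_div_cancel₀ _ hδ.ne'
    have h5 := mul_le_mul_of_nonneg_left h1 hδ.le
    have h6 := mul_le_mul_of_nonneg_left h2 hδ.le
    rw [mul_sub, mul_sub, h3, h4] at h6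
    linarith
  · intro a b c
    simp only [add_sub_add_right_eq_sub]
    ring
  · intro a b h
    simp [hzero _ (div_nonpos_of_nonpos_of_nonneg (sub_nonpos.2 h) hδ.le)]
  · intro a b
    have h1 := mul_le_mul_of_nonneg_left (hle ((b - a) / δ)) hδ.le
    rw [mul_sub, mul_div_cancel₀ _ hδ.ne'] at h1
    linarith

/-- The approximate maximum of `c, g 0, …, g (n - 1)` obtained by iterating `m`. -/
def iterMax {X : Type*} (m : ℝ → ℝ → ℝ) (c : ℝ) (g : ℕ → X → ℝ) : ℕ → X → ℝ
  | 0 => fun _ => c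
  | n + 1 => fun x => m (iterMax m c g n x) (g n x)

namespace IsSmoothMax

variable {m : ℝ → ℝ → ℝ} {δ : ℝ} {X : Type*} {c : ℝ} {g : ℕ → X → ℝ}

lemma iterMax_contDiff (hm : IsSmoothMax m δ) [NormedAddCommGroup X] [NormedSpace ℝ X]
    {p : ℕ∞} (hg : ∀ n, ContDiff ℝ p (g n)) (n : ℕ) : ContDiff ℝ p (iterMax m c g n) := by
  induction n with
  | zero => exact contDiff_const
  | succ n ih => exact hm.comp_contDiff ih (hg n)

lemma iterMax_lipschitz (hm : IsSmoothMax m δ) [PseudoMetricSpace X]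
    {C : ℝ≥0} (hg : ∀ n, LipschitzWith C (g n)) (n : ℕ) : LipschitzWith C (iterMax m c g n) := by
  induction n with
  | zero => exact (LipschitzWith.const c).weaken zero_le
  | succ n ih => exact hm.comp_lipschitz ih (hg n)

lemma iterMax_mono (hm : IsSmoothMax m δ) (x : X) : Monotone fun n => iterMax m c g n x :=
  monotone_nat_of_le_succ fun _ => hm.left_le _ _

lemma iterMax_le (hm : IsSmoothMax m δ) {x : X} {n : ℕ} {d : ℝ} (hc : c ≤ d)
    (hg : ∀ i < n, g i x ≤ d) : iterMax m c g n x ≤ d := by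
  induction n with
  | zero => exact hc
  | succ n ih =>
    exact hm.le_of_le (ih fun i hi => hg i (hi.trans n.lt_succ_self)) (hg n n.lt_succ_self)

lemma sub_le_iterMax (hm : IsSmoothMax m δ) {x : X} {i n : ℕ} (h : i < n) :
    g i x - δ ≤ iterMax m c g n x :=
  (hm.sub_le (iterMax m c g i x) (g i x)).trans (hm.iterMax_mono x (Nat.succ_le_of_lt h))

lemma iterMax_eq (hm : IsSmoothMax m δ) {x : X} {N n : ℕ} (h : N ≤ n)
    (hg : ∀ i, N ≤ i → g i x ≤ c) : iterMax m c g n x = iterMax m c g N x := by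
  induction n, h using Nat.le_induction with
  | base => rfl
  | succ n hn ih =>
    rw [← ih]
    exact hm.eq_left ((hg n hn).trans (hm.iterMax_mono x (Nat.zero_le n)))

end IsSmoothMax

/-- A sequence of `C^p`-smooth, equi-Lipschitz functions which is locally eventually constant
has a `C^p`-smooth Lipschitz pointwise limit. -/
lemma exists_contDiff_lipschitz_limit {X : Type*} [NormedAddCommGroup X] [NormedSpace ℝ X]
    {p : ℕ∞} {C : ℝ≥0} {u : ℕ → X → ℝ} (hu : ∀ n, ContDiff ℝ p (u n))
    (hC : ∀ n, LipschitzWith C (u n))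
    (hloc : ∀ x, ∃ N, ∀ᶠ y in 𝓝 x, ∀ n, N ≤ n → u n y = u N y) :
    ∃ U : X → ℝ, ContDiff ℝ p U ∧ LipschitzWith C U ∧
      ∀ x, ∃ N, ∀ n, N ≤ n → U x = u n x := by
  choose N hN using hloc
  have hU (x : X) (n : ℕ) (hn : N x ≤ n) : u (N x) x = u n x := ((hN x).self_of_nhds n hn).symm
  refine ⟨fun x => u (N x) x, ?_, ?_, fun x => ⟨N x, hU x⟩⟩
  · refine contDiff_iff_contDiffAt.2 fun x => ?_
    refine (hu (N x)).contDiffAt.congr_of_eventuallyEq ?_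
    filter_upwards [hN x] with y hy
    rw [hU y _ (le_max_right (N x) (N y)), hy _ (le_max_left _ _)]
  · refine LipschitzWith.of_le_add_mul C fun x y => ?_
    rw [hU x _ (le_max_left (N x) (N y)), hU y _ (le_max_right (N x) (N y))]
    exact (hC _).le_add_mul x y

lemma exists_lipschitzWith_smoothTransition : ∃ C : ℝ≥0, LipschitzWith C Real.smoothTransition := by
  have hs : ContDiff ℝ 1 Real.smoothTransition := Real.smoothTransition.contDiff
  obtain ⟨C, hC⟩ := (isCompact_Icc (a := (0 : ℝ)) (b := 1)).exists_bound_of_continuousOn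
    (hs.continuous_deriv le_rfl).continuousOn
  refine ⟨C.toNNReal, lipschitzWith_of_nnnorm_deriv_le (hs.differentiable one_ne_zero) fun x => ?_⟩
  rw [← NNReal.coe_le_coe, coe_nnnorm]
  refine le_trans ?_ (Real.le_coe_toNNReal C)
  by_cases hx : x ∈ Set.Icc (0 : ℝ) 1
  · exact hC x hx
  have h0 : deriv Real.smoothTransition x = 0 := by
    rw [Set.mem_Icc, not_and_or, not_le, not_le] at hx
    rcases hx with hx | hx
    · have : Real.smoothTransition =ᶠ[𝓝 x] fun _ => 0 := by
        filter_upwards [Iio_mem_nhds hx] with y hy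
        exact Real.smoothTransition.zero_of_nonpos (le_of_lt hy)
      rw [this.deriv_eq, deriv_const]
    · have : Real.smoothTransition =ᶠ[𝓝 x] fun _ => 1 := by
        filter_upwards [Ioi_mem_nhds hx] with y hy
        exact Real.smoothTransition.one_of_one_le (le_of_lt hy)
      rw [this.deriv_eq, deriv_const]
  rw [h0, norm_zero]
  exact (norm_nonneg _).trans (hC 0 (by simp))

/-- A smooth Lipschitz step function on the line. -/
lemma exists_smooth_step {a b : ℝ} (hab : a < b) : ∃ θ : ℝ → ℝ, ContDiff ℝ ∞ θ ∧
    (∃ C : ℝ≥0, LipschitzWith C θ) ∧ (∀ t, θ t ∈ Set.Icc (0 : ℝ) 1) ∧ (∀ t ≤ a, θ t = 0) ∧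
    ∀ t, b ≤ t → θ t = 1 := by
  obtain ⟨C, hC⟩ := exists_lipschitzWith_smoothTransition
  have hpos : 0 < (b - a)⁻¹ := inv_pos.2 (sub_pos.2 hab)
  refine ⟨fun t => Real.smoothTransition ((b - a)⁻¹ * (t - a)), ?_, ?_, fun t => ?_, ?_, ?_⟩
  · exact Real.smoothTransition.contDiff.comp
      (contDiff_const.mul (contDiff_id.sub contDiff_const))
  · refine ⟨C * ‖(b - a)⁻¹‖₊, hC.comp (LipschitzWith.of_dist_le_mul fun x y => ?_)⟩
    rw [Real.dist_eq, Real.dist_eq, ← mul_sub, abs_mul, sub_sub_sub_cancel_right]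
    simp
  · exact ⟨Real.smoothTransition.nonneg _, Real.smoothTransition.le_one _⟩
  · intro t ht
    exact Real.smoothTransition.zero_of_nonpos
      (mul_nonpos_of_nonneg_of_nonpos hpos.le (sub_nonpos.2 ht))
  · intro t ht
    refine Real.smoothTransition.one_of_one_le ?_
    rw [inv_mul_eq_div, one_le_div (sub_pos.2 hab)]
    linarith

/-- A normalized bump: equal to `1` near the origin, and supported in a given ball. -/
lemma HasLipschitzSmoothBump.exists_normalized {X : Type*} [NormedAddCommGroup X]
    [NormedSpace ℝ X] {p : ℕ∞} (h : HasLipschitzSmoothBump X p) {r : ℝ} (hr : 0 < r) :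
    ∃ b : X → ℝ, ContDiff ℝ p b ∧ (∃ C : ℝ≥0, LipschitzWith C b) ∧
      (∀ x, b x ∈ Set.Icc (0 : ℝ) 1) ∧ (∀ᶠ x in 𝓝 0, b x = 1) ∧ ∀ x, b x ≠ 0 → ‖x‖ < r := by
  obtain ⟨b, hb, ⟨C, hC⟩, hbdd, x₀, hx₀⟩ := h
  obtain ⟨R, hR⟩ := (hbdd.subset subset_closure).exists_norm_le
  obtain ⟨θ, hθ, ⟨D, hD⟩, hθ01, hθ0, hθ1⟩ := exists_smooth_step (a := 0) (b := 1 / 2) (by norm_num)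
  set M : ℝ := |R| + ‖x₀‖ + 1 with hM
  have hMpos : 0 < M := by positivity
  set k : ℝ := M / r with hk
  have hkpos : 0 < k := by positivity
  set w : X → ℝ := fun x => (b x₀)⁻¹ * b (k • x + x₀) with hw
  have hx₀' : b x₀ ≠ 0 := hx₀
  have hwc : ContDiff ℝ p w :=
    contDiff_const.mul (hb.comp ((contDiff_id.const_smul k).add contDiff_const))
  have hw0 : w 0 = 1 := by simp [hw, hx₀']
  refine ⟨fun x => θ (w x), (hθ.of_le (mod_cast le_top)).comp hwc, ?_, fun x => hθ01 _, ?_, ?_⟩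
  · refine ⟨D * (‖(b x₀)⁻¹‖₊ * (C * ‖k‖₊)), hD.comp (LipschitzWith.of_dist_le_mul fun x y => ?_)⟩
    have h1 := hC.dist_le_mul (k • x + x₀) (k • y + x₀)
    rw [dist_add_right, dist_smul₀] at h1
    rw [hw, Real.dist_eq, ← mul_sub, abs_mul, ← Real.dist_eq]
    simp only [NNReal.coe_mul, coe_nnnorm, Real.norm_eq_abs] at h1 ⊢
    rw [mul_assoc, mul_assoc]
    exact mul_le_mul_of_nonneg_left h1 (abs_nonneg _)
  · have : ∀ᶠ x in 𝓝 0, 1 / 2 < w x :=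
      hwc.continuous.continuousAt.eventually (lt_mem_nhds (by rw [hw0]; norm_num))
    filter_upwards [this] with x hx
    exact hθ1 _ hx.le
  · intro x hx
    have h1 : b (k • x + x₀) ≠ 0 := fun h0 => hx (hθ0 _ (by simp [hw, h0]))
    have h2 : ‖k • x + x₀‖ ≤ R := hR _ h1
    have h3 : ‖k • x‖ ≤ ‖k • x + x₀‖ + ‖x₀‖ := by
      simpa using norm_sub_le (k • x + x₀) x₀
    rw [norm_smul, Real.norm_of_nonneg hkpos.le] at h3
    have h4 : M / r * ‖x‖ < M := by linarith [le_abs_self R]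
    rw [div_mul_eq_mul_div, div_lt_iff₀ hr] at h4
    exact lt_of_mul_lt_mul_left h4 hMpos.le

/-- On a separable space with a Lipschitz `C^p`-smooth bump, sets at a given positive distance
are separated by `C^p`-smooth functions with a uniform Lipschitz constant. -/
lemma HasLipschitzSmoothBump.exists_separation {X : Type*} [NormedAddCommGroup X]
    [NormedSpace ℝ X] [TopologicalSpace.SeparableSpace X] {p : ℕ∞}
    (hbump : HasLipschitzSmoothBump X p) {r : ℝ} (hr : 0 < r) :
    ∃ C : ℝ≥0, ∀ A B : Set X, (∀ a ∈ A, ∀ b ∈ B, 2 * r ≤ dist a b) →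
      ∃ h : X → ℝ, ContDiff ℝ p h ∧ LipschitzWith C h ∧ (∀ x, h x ∈ Set.Icc (0 : ℝ) 1) ∧
        (∀ x ∈ A, h x = 0) ∧ ∀ x ∈ B, h x = 1 := by
  classical
  obtain ⟨b, hb, ⟨C, hC⟩, hb01, hb1, hbr⟩ := hbump.exists_normalized hr
  obtain ⟨m, hm⟩ := exists_isSmoothMax (δ := 1 / 8) (by norm_num)
  obtain ⟨θ, hθ, ⟨D, hD⟩, hθ01, hθ0, hθ1⟩ :=
    exists_smooth_step (a := 1 / 4) (b := 3 / 8) (by norm_num)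
  refine ⟨D * C, fun A B hAB => ?_⟩
  set z : ℕ → X := TopologicalSpace.denseSeq X
  set β : ℕ → X → ℝ := fun n x => b (x - z n)
  have hβ (n : ℕ) : ContDiff ℝ p (β n) := hb.comp (contDiff_id.sub contDiff_const)
  have hβC (n : ℕ) : LipschitzWith C (β n) := LipschitzWith.of_dist_le_mul fun x y => by
    simpa using hC.dist_le_mul (x - z n) (y - z n)
  have hβr (n : ℕ) (x : X) (hx : β n x ≠ 0) : dist x (z n) < r := by
    rw [dist_eq_norm]; exact hbr _ hx
  have hβ1 (x : X) : ∃ n, ∀ᶠ y in 𝓝 x, β n y = 1 := by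
    obtain ⟨ρ, hρ, hball⟩ := Metric.eventually_nhds_iff.1 hb1
    obtain ⟨n, hn⟩ := (TopologicalSpace.denseRange_denseSeq X).exists_dist_lt x hρ
    refine ⟨n, ?_⟩
    filter_upwards [Metric.isOpen_ball.mem_nhds (Metric.mem_ball.2 hn)] with y hy
    exact hball (by rwa [dist_zero_right, ← dist_eq_norm])
  set φ : ℕ → X → ℝ := fun n x => 1 - m (iterMax m 0 β n x) (1 - β n x) with hφ
  have hφc (n : ℕ) : ContDiff ℝ p (φ n) :=
    contDiff_const.sub (hm.comp_contDiff (hm.iterMax_contDiff hβ n) (contDiff_const.sub (hβ n)))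
  have one_sub {u : X → ℝ} (hu : LipschitzWith C u) : LipschitzWith C fun x => 1 - u x :=
    LipschitzWith.of_dist_le_mul fun x y => by
      rw [dist_sub_left]
      exact hu.dist_le_mul x y
  have hφC (n : ℕ) : LipschitzWith C (φ n) :=
    one_sub (hm.comp_lipschitz (hm.iterMax_lipschitz hβC n) (one_sub (hβC n)))
  have hφβ (n : ℕ) (x : X) : φ n x ≤ β n x + 1 / 8 := by
    linarith [hm.sub_le (iterMax m 0 β n x) (1 - β n x)]
  have hφle {i n : ℕ} (h : i < n) (x : X) : φ n x ≤ 1 - β i x + 1 / 8 := by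
    linarith [hm.left_le (iterMax m 0 β n x) (1 - β n x),
      hm.sub_le_iterMax (c := 0) (g := β) (x := x) h]
  set J : Set ℕ := {n | ∃ y ∈ B, dist y (z n) < r}
  set ψ : ℕ → X → ℝ := fun n => if n ∈ J then φ n else fun _ => 0 with hψ
  have hψc (n : ℕ) : ContDiff ℝ p (ψ n) := by
    by_cases h : n ∈ J
    · simpa only [hψ, if_pos h] using hφc n
    · simpa only [hψ, if_neg h] using contDiff_const
  have hψC (n : ℕ) : LipschitzWith C (ψ n) := by
    by_cases h : n ∈ J
    · simpa only [hψ, if_pos h] using hφC n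
    · simpa only [hψ, if_neg h] using (LipschitzWith.const (0 : ℝ)).weaken zero_le
  have hψle (n : ℕ) (x : X) (h : n ∈ J → φ n x ≤ 1 / 4) : ψ n x ≤ 1 / 4 := by
    by_cases hn : n ∈ J
    · simpa only [hψ, if_pos hn] using h hn
    · simp [hψ, if_neg hn]
  obtain ⟨U, hU, hUC, hUlim⟩ := exists_contDiff_lipschitz_limit
    (hm.iterMax_contDiff (c := 1 / 4) hψc) (hm.iterMax_lipschitz hψC) fun x => by
      obtain ⟨i, hi⟩ := hβ1 x
      refine ⟨i + 1, ?_⟩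
      filter_upwards [hi] with y hy n hn
      refine hm.iterMax_eq hn fun j hj => hψle j y fun _ => ?_
      linarith [hφle (Nat.lt_of_succ_le hj) y]
  refine ⟨fun x => θ (U x), (hθ.of_le (mod_cast le_top)).comp hU, hD.comp hUC,
    fun x => hθ01 _, fun x hx => hθ0 _ ?_, fun x hx => hθ1 _ ?_⟩
  · obtain ⟨N, hN⟩ := hUlim x
    rw [hN N le_rfl]
    refine hm.iterMax_le le_rfl fun i _ => hψle i x fun ⟨y, hy, hyr⟩ => ?_
    have hzero : β i x = 0 := by
      by_contra h0
      linarith [hAB x hx y hy, hβr i x h0, dist_triangle_right x y (z i)]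
    linarith [hφβ i x]
  · have hex : ∃ n, 1 / 2 ≤ β n x := by
      obtain ⟨n, hn⟩ := hβ1 x
      exact ⟨n, by rw [hn.self_of_nhds]; norm_num⟩
    obtain ⟨N, hN⟩ := hUlim x
    set i := Nat.find hex
    have hi : 1 / 2 ≤ β i x := Nat.find_spec hex
    have hiJ : i ∈ J := ⟨x, hx, hβr i x (by linarith)⟩
    have h1 : iterMax m 0 β i x ≤ 1 / 2 :=
      hm.iterMax_le (by norm_num) fun k hk => (not_le.1 (Nat.find_min hex hk)).le
    have h2 : m (iterMax m 0 β i x) (1 - β i x) ≤ 1 / 2 := hm.le_of_le h1 (by linarith)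
    have h3 : ψ i x = φ i x := by simp only [hψ, if_pos hiJ]
    rw [hN _ (le_max_left N (i + 1))]
    have h4 := hm.sub_le_iterMax (c := 1 / 4) (g := ψ) (x := x)
      (Nat.lt_of_succ_le (le_max_right N (i + 1)))
    linarith

/-- Lipschitz functions are within distance `1` of `C^p`-smooth Lipschitz functions. -/
lemma HasLipschitzSmoothBump.exists_approx_one {X : Type*} [NormedAddCommGroup X]
    [NormedSpace ℝ X] [TopologicalSpace.SeparableSpace X] {p : ℕ∞}
    (hbump : HasLipschitzSmoothBump X p) {L : ℝ≥0} {F : X → ℝ} (hF : LipschitzWith L F) :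
    ∃ K : X → ℝ, ContDiff ℝ p K ∧ (∃ C : ℝ≥0, LipschitzWith C K) ∧ ∀ x, |F x - K x| ≤ 1 := by
  set ρ : ℝ := 1 / (L + 1) with hρ
  have hρpos : 0 < ρ := by positivity
  have hFρ {x y : X} (h : dist x y < ρ) : |F x - F y| < 1 := by
    rw [hρ, lt_div_iff₀ (by positivity)] at h
    have h1 := hF.dist_le_mul x y
    rw [Real.dist_eq] at h1
    nlinarith [dist_nonneg (x := x) (y := y)]
  obtain ⟨C, hC⟩ := hbump.exists_separation (half_pos hρpos)
  have hsep (n : ℤ) := hC {x | F x ≤ n} {x | n + 1 ≤ F x} fun x hx y hy => by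
    by_contra! hlt
    rw [mul_div_cancel₀ _ two_ne_zero] at hlt
    have hx' : F x ≤ n := hx
    have hy' : n + 1 ≤ F y := hy
    linarith [(abs_lt.1 (hFρ hlt)).1]
  choose h hh hhC h01 h0 h1 using hsep
  set K : X → ℝ := fun x => ⌊F x⌋ + h ⌊F x⌋ x with hK
  have hloc {x y : X} (hxy : dist y x < ρ) : K y =
      ⌊F x⌋ - 1 + h (⌊F x⌋ - 1) y + h ⌊F x⌋ y + h (⌊F x⌋ + 1) y := by
    have hlt := abs_lt.1 (hFρ hxy)
    have hx1 := Int.floor_le (F x)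
    have hx2 := Int.lt_floor_add_one (F x)
    have hy1 := Int.floor_le (F y)
    have hy2 := Int.lt_floor_add_one (F y)
    set k := ⌊F x⌋
    set l := ⌊F y⌋ with hl
    have hkl : l = k - 1 ∨ l = k ∨ l = k + 1 := by
      have e1 : (k : ℝ) < l + 2 := by linarith
      have e2 : (l : ℝ) < k + 2 := by linarith
      have e1' : k < l + 2 := by exact_mod_cast e1
      have e2' : l < k + 2 := by exact_mod_cast e2
      omega
    simp only [hK, ← hl]
    rcases hkl with e | e | e
    · have e' : (l : ℝ) = k - 1 := by rw [e]; push_cast; ring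
      rw [h0 k y (by simp only [Set.mem_ofPred_eq]; linarith),
        h0 (k + 1) y (by simp only [Set.mem_ofPred_eq]; push_cast; linarith), e', e]
      ring
    · rw [h1 (k - 1) y (by simp only [Set.mem_ofPred_eq]; push_cast; rw [← e]; linarith),
        h0 (k + 1) y (by simp only [Set.mem_ofPred_eq]; push_cast; rw [← e]; linarith), e]
      ring
    · have e' : (l : ℝ) = k + 1 := by rw [e]; push_cast; ring
      rw [h1 (k - 1) y (by simp only [Set.mem_ofPred_eq]; push_cast; linarith),
        h1 k y (by simp only [Set.mem_ofPred_eq]; linarith), e', e]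
      ring
  have hclose (x : X) : |F x - K x| ≤ 1 := by
    obtain ⟨a, b⟩ := h01 ⌊F x⌋ x
    rw [abs_le]
    constructor <;> simp only [hK] <;> linarith [Int.floor_le (F x), Int.lt_floor_add_one (F x)]
  refine ⟨K, contDiff_iff_contDiffAt.2 fun x => ?_, ?_, hclose⟩
  · refine ContDiffAt.congr_of_eventuallyEq (f := fun y =>
      ⌊F x⌋ - 1 + h (⌊F x⌋ - 1) y + h ⌊F x⌋ y + h (⌊F x⌋ + 1) y) ?_ ?_
    · exact (((contDiff_const.add (hh _)).add (hh _)).add (hh _)).contDiffAt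
    · filter_upwards [Metric.ball_mem_nhds x hρpos] with y hy
      exact hloc hy
  · refine ⟨3 * C + L + 2 * (L + 1), LipschitzWith.of_le_add_mul _ fun y x => ?_⟩
    have hd := dist_nonneg (x := y) (y := x)
    have hCd : 0 ≤ (C : ℝ) * dist y x := by positivity
    have hLd : 0 ≤ (L : ℝ) * dist y x := by positivity
    push_cast
    rcases lt_or_ge (dist y x) ρ with hlt | hge
    · rw [hloc hlt, hloc (x := x) (y := x) (by simpa using hρpos)]
      nlinarith [(hhC (⌊F x⌋ - 1)).le_add_mul y x, (hhC ⌊F x⌋).le_add_mul y x,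
        (hhC (⌊F x⌋ + 1)).le_add_mul y x]
    · rw [hρ, div_le_iff₀ (by positivity)] at hge
      nlinarith [hF.le_add_mul y x, abs_le.1 (hclose x), abs_le.1 (hclose y)]

lemma HasUnconditionalSchauderBasis.separableSpace {X : Type*} [NormedAddCommGroup X]
    [NormedSpace ℝ X] (h : HasUnconditionalSchauderBasis X) :
    TopologicalSpace.SeparableSpace X := by
  obtain ⟨e, he⟩ := h
  have hsep : TopologicalSpace.IsSeparable (closure (Submodule.span ℝ (Set.range e) : Set X)) :=
    (Set.countable_range e).isSeparable.span.closure
  rw [← TopologicalSpace.isSeparable_univ_iff]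
  refine hsep.mono fun x _ => ?_
  obtain ⟨a, ha, -⟩ := he x
  exact mem_closure_of_tendsto ha (Filter.Eventually.of_forall fun s =>
    Submodule.sum_mem _ fun i _ => Submodule.smul_mem _ _ (Submodule.subset_span ⟨i, rfl⟩))

/-- A uniformly continuous function on a convex set is Lipschitz for large distances. -/
lemma Convex.exists_abs_sub_le_of_uniformContinuous {X : Type*} [NormedAddCommGroup X]
    [NormedSpace ℝ X] {Y : Set X} (hY : Convex ℝ Y) {f : Y → ℝ} (hf : UniformContinuous f)
    {η : ℝ} (hη : 0 < η) :
    ∃ L : ℝ≥0, ∀ x y : Y, |f x - f y| ≤ L * dist x y + η := by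
  obtain ⟨δ, hδ, hfδ⟩ := Metric.uniformContinuous_iff.1 hf η hη
  refine ⟨⟨η / δ, by positivity⟩, fun x y => ?_⟩
  set N : ℕ := ⌊dist x y / δ⌋₊ + 1 with hN
  have hNpos : (0 : ℝ) < N := by positivity
  have hdN : dist x y < N * δ := by
    rw [← div_lt_iff₀ hδ, hN]
    exact_mod_cast Nat.lt_floor_add_one _
  have hNle : (N : ℝ) ≤ dist x y / δ + 1 := by
    rw [hN]; push_cast
    linarith [Nat.floor_le (a := dist x y / δ) (by positivity)]
  have hmem (i : ℕ) (hi : i ≤ N) : AffineMap.lineMap (x : X) (y : X) ((i : ℝ) / N) ∈ Y :=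
    hY.lineMap_mem x.2 y.2 ⟨by positivity, div_le_one_of_le₀ (by exact_mod_cast hi) hNpos.le⟩
  have hstep (i : ℕ) (hi : i ≤ N) : |f x - f ⟨_, hmem i hi⟩| ≤ i * η := by
    induction i with
    | zero => simp
    | succ i ih =>
      have h1 := ih (by omega)
      have h2 : dist (f ⟨_, hmem i (by omega)⟩) (f ⟨_, hmem (i + 1) hi⟩) < η := by
        refine hfδ ?_
        rw [Subtype.dist_eq, dist_lineMap_lineMap, Real.dist_eq]
        have : (i : ℝ) / N - ((i + 1 : ℕ) : ℝ) / N = -(1 / N) := by push_cast; ring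
        rw [this, abs_neg, abs_of_pos (by positivity), one_div, inv_mul_lt_iff₀ hNpos]
        exact hdN
      rw [Real.dist_eq] at h2
      have h3 : ((i + 1 : ℕ) : ℝ) * η = i * η + η := by push_cast; ring
      rw [h3]
      linarith [abs_sub_le (f x) (f ⟨_, hmem i (by omega)⟩) (f ⟨_, hmem (i + 1) hi⟩)]
  have hlast := hstep N le_rfl
  have hend : (⟨_, hmem N le_rfl⟩ : Y) = y := by
    ext; simp
  rw [hend] at hlast
  calc |f x - f y| ≤ N * η := hlast
    _ ≤ (dist x y / δ + 1) * η := by gcongr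
    _ = η / δ * dist x y + η := by ring

/-- A function which is Lipschitz up to `η` is within `η` of a Lipschitz function defined
on the whole space. -/
lemma exists_lipschitzWith_approx {X : Type*} [PseudoMetricSpace X] {Y : Set X} {f : Y → ℝ}
    {L : ℝ≥0} {η : ℝ} (hf : ∀ x y : Y, |f x - f y| ≤ L * dist x y + η) :
    ∃ F : X → ℝ, LipschitzWith L F ∧ ∀ y : Y, |f y - F y| ≤ η := by
  rcases isEmpty_or_nonempty Y with hE | ⟨⟨y₀⟩⟩
  · exact ⟨fun _ => 0, (LipschitzWith.const 0).weaken zero_le, fun y => hE.elim y⟩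
  have hne : Nonempty Y := ⟨y₀⟩
  have hbdd (x : X) : BddBelow (Set.range fun y : Y => f y + L * dist x y) := by
    refine ⟨f y₀ - η - L * dist x y₀, ?_⟩
    rintro _ ⟨y, rfl⟩
    have h1 : (L : ℝ) * dist y₀ y ≤ L * (dist x y₀ + dist x y) := by
      gcongr
      rw [Subtype.dist_eq]
      exact dist_triangle_left _ _ _
    dsimp only
    linarith [(abs_le.1 (hf y₀ y)).2]
  refine ⟨fun x => ⨅ y : Y, (f y + L * dist x y), LipschitzWith.of_le_add_mul L fun x x' => ?_,
    fun y => abs_le.2 ⟨?_, ?_⟩⟩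
  · rw [← sub_le_iff_le_add]
    refine le_ciInf fun y => ?_
    have h1 : (L : ℝ) * dist x y ≤ L * (dist x x' + dist x' y) := by
      gcongr
      exact dist_triangle _ _ _
    linarith [ciInf_le (hbdd x) y]
  · have := ciInf_le (hbdd y) y
    rw [dist_self] at this
    have hη := hf y y
    simp at hη
    linarith
  · have : f y - η ≤ ⨅ y' : Y, (f y' + L * dist (y : X) y') := le_ciInf fun y' => by
      have := (abs_le.1 (hf y y')).2
      rw [Subtype.dist_eq] at this
      linarith
    linarith

/-- Theorem 1 (first part): if `X` is a Banach space with an unconditional Schauder basis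
admitting a Lipschitz `C^p`-smooth bump, `Y ⊆ X` is convex and `f : Y → ℝ` is uniformly
continuous, then for every `ε > 0` there is a Lipschitz, `C^p`-smooth `K : X → ℝ` with
`|f y - K y| < ε` for all `y ∈ Y`. -/
theorem smooth_lipschitz_approx_of_uniformlyContinuous_on_convex
    {X : Type*} [NormedAddCommGroup X] [NormedSpace ℝ X] [CompleteSpace X]
    (p : ℕ∞) (hp : 1 ≤ p)
    (hbasis : HasUnconditionalSchauderBasis X)
    (hbump : HasLipschitzSmoothBump X p)
    (Y : Set X) (hY : Convex ℝ Y)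
    (f : Y → ℝ) (hf : UniformContinuous f)
    (ε : ℝ) (hε : 0 < ε) :
    ∃ K : X → ℝ, ContDiff ℝ p K ∧ (∃ C : NNReal, LipschitzWith C K) ∧
      ∀ y : Y, |f y - K (y : X)| < ε := by
  have := hbasis.separableSpace
  obtain ⟨L, hL⟩ := hY.exists_abs_sub_le_of_uniformContinuous hf (half_pos hε)
  obtain ⟨F, hF, hfF⟩ := exists_lipschitzWith_approx hL
  set c : ℝ := ε / 3 with hc
  have hcpos : 0 < c := by positivity
  have hscaled : LipschitzWith (‖c⁻¹‖₊ * L) fun x => c⁻¹ * F x :=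
    (lipschitzWith_smul c⁻¹).comp hF
  obtain ⟨K, hK, ⟨C, hC⟩, hFK⟩ := hbump.exists_approx_one hscaled
  refine ⟨fun x => c * K x, contDiff_const.mul hK,
    ⟨‖c‖₊ * C, (lipschitzWith_smul c).comp hC⟩, fun y => ?_⟩
  have h1 : |F y - c * K y| ≤ c := by
    have h2 : F y - c * K y = c * (c⁻¹ * F y - K y) := by
      rw [mul_sub, mul_inv_cancel_left₀ hcpos.ne']
    rw [h2, abs_mul, abs_of_pos hcpos]
    exact mul_le_of_le_one_right hcpos.le (hFK y)
  linarith [abs_sub_le (f y) (F y) (c * K y), hfF y]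
end

section
/- Let X be a Banach space with an unconditional Schauder basis which admits a Lipschitz, C^p-smooth bump function, and let Z be any Banach space. There exists a constant C₀ > 1, depending only on X (in particular independent of ε), such that: for every η-Lipschitz map f : X → Z and every ε > 0, there exists a C^p-smooth map K : X → Z with ‖f(x) − K(x)‖ < ε for all x ∈ X and with Lipschitz constant of K no larger than C₀η. -/
open Function Bornology

open Filter Topology
open scoped ENNReal

/-- The finite partial sums of a summable family in a normed group are bounded. -/
theorem Summable.exists_norm_finset_sum_le {ι E : Type*} [SeminormedAddCommGroup E] {v : ι → E}
    (hv : Summable v) : ∃ M, ∀ F : Finset ι, ‖∑ j ∈ F, v j‖ ≤ M := by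
  classical
  have hc : CauchySeq fun F : Finset ι => ∑ j ∈ F, v j := hv.hasSum.cauchySeq
  obtain ⟨s, hs⟩ := cauchySeq_finset_iff_vanishing_norm.1 hc 1 one_pos
  refine ⟨∑ j ∈ s, ‖v j‖ + 1, fun F => ?_⟩
  rw [← Finset.sum_inter_add_sum_sdiff F s]
  refine (norm_add_le _ _).trans (add_le_add ?_ (hs _ Finset.sdiff_disjoint).le)
  exact (norm_sum_le _ _).trans
    (Finset.sum_le_sum_of_subset_of_nonneg Finset.inter_subset_right fun _ _ _ => norm_nonneg _)

/-- If the finite partial sums of a family are bounded by `M`, then so is its sum. -/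
theorem HasSum.norm_le_of_forall_finset {ι E : Type*} [SeminormedAddCommGroup E] {v : ι → E} {x : E}
    (hv : HasSum v x) {M : ℝ} (hM : ∀ F : Finset ι, ‖∑ j ∈ F, v j‖ ≤ M) : ‖x‖ ≤ M :=
  le_of_tendsto (tendsto_norm.comp hv) (Eventually.of_forall hM)

theorem lp_infty_continuous_eval {ι X : Type*} [NormedAddCommGroup X] (F : ι) :
    Continuous fun u : lp (fun _ : ι => X) ∞ => u F :=
  (LipschitzWith.of_dist_le_mul (K := 1) fun u v => by
    rw [dist_eq_norm, dist_eq_norm, NNReal.coe_one, one_mul]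
    simpa using lp.norm_apply_le_norm ENNReal.top_ne_zero (u - v) F).continuous

section CoordinateContinuity

variable {X : Type*} [NormedAddCommGroup X] [NormedSpace ℝ X]

/-- The space of convergent expansions `∑ⱼ aⱼ eⱼ`, each of them represented by the bounded family
of its finite partial sums. -/
def expansionSpace (e : ℕ → X) : Submodule ℝ (lp (fun _ : Finset ℕ => X) ∞) where
  carrier := {u | (∀ F : Finset ℕ, u F = ∑ j ∈ F, u {j}) ∧ (∀ j, u {j} ∈ Submodule.span ℝ {e j}) ∧
    Summable fun j => u {j}}
  zero_mem' := ⟨by simp, by simp, by simp⟩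
  add_mem' := by
    rintro u v ⟨hu, hu', hu''⟩ ⟨hv, hv', hv''⟩
    refine ⟨fun F => ?_, fun j => ?_, ?_⟩
    · simp only [lp.coeFn_add, Pi.add_apply, Finset.sum_add_distrib, ← hu F, ← hv F]
    · exact Submodule.add_mem _ (hu' j) (hv' j)
    · simpa using hu''.add hv''
  smul_mem' := by
    rintro c u ⟨hu, hu', hu''⟩
    refine ⟨fun F => ?_, fun j => ?_, ?_⟩
    · simp only [lp.coeFn_smul, Pi.smul_apply, ← Finset.smul_sum, ← hu F]
    · exact Submodule.smul_mem _ _ (hu' j)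
    · simpa using hu''.const_smul c

theorem isClosed_expansionSpace [CompleteSpace X] (e : ℕ → X) :
    IsClosed (expansionSpace e : Set (lp (fun _ : Finset ℕ => X) ∞)) := by
  have h1 : IsClosed {u : lp (fun _ : Finset ℕ => X) ∞ | ∀ F : Finset ℕ, u F = ∑ j ∈ F, u {j}} := by
    simp only [Set.ofPred_forall]
    exact isClosed_iInter fun F => isClosed_eq (lp_infty_continuous_eval F)
      (continuous_finsetSum _ fun j _ => lp_infty_continuous_eval _)
  have h2 : IsClosed {u : lp (fun _ : Finset ℕ => X) ∞ | ∀ j, u {j} ∈ Submodule.span ℝ {e j}} := by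
    simp only [Set.ofPred_forall]
    exact isClosed_iInter fun j => (Submodule.closed_of_finiteDimensional
      (Submodule.span ℝ {e j})).preimage (lp_infty_continuous_eval _)
  refine isClosed_of_closure_subset fun u hu => ?_
  have hu1 := closure_minimal (fun w hw => hw.1) h1 hu
  refine ⟨hu1, closure_minimal (fun w hw => hw.2.1) h2 hu, ?_⟩
  rw [summable_iff_vanishing_norm]
  intro ε hε
  obtain ⟨w, hw, hd⟩ := Metric.mem_closure_iff.1 hu (ε / 2) (by positivity)
  obtain ⟨s, hs⟩ := summable_iff_vanishing_norm.1 hw.2.2 (ε / 2) (by positivity)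
  refine ⟨s, fun t ht => ?_⟩
  have h3 := hs t ht
  rw [← hw.1] at h3
  rw [← hu1]
  have h4 : ‖u t - w t‖ ≤ ‖u - w‖ := by
    simpa using lp.norm_apply_le_norm ENNReal.top_ne_zero (u - w) t
  rw [dist_eq_norm] at hd
  calc ‖u t‖ = ‖(u t - w t) + w t‖ := by simp
    _ ≤ ‖u t - w t‖ + ‖w t‖ := norm_add_le _ _
    _ < ε := by linarith

/-- The sum of an expansion, as a continuous linear map. -/
noncomputable def expansionSum (e : ℕ → X) : expansionSpace e →L[ℝ] X :=
  LinearMap.mkContinuous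
    { toFun := fun u => ∑' j, u.1 {j}
      map_add' := fun u v => by simpa using u.2.2.2.tsum_add v.2.2.2
      map_smul' := fun c u => by simpa using u.2.2.2.tsum_const_smul c } 1 fun u => by
    refine HasSum.norm_le_of_forall_finset u.2.2.2.hasSum fun F => ?_
    rw [← u.2.1, one_mul]
    exact lp.norm_apply_le_norm ENNReal.top_ne_zero u.1 F

theorem hasSum_expansionSum (e : ℕ → X) (u : expansionSpace e) :
    HasSum (fun j => u.1 {j}) (expansionSum e u) :=
  u.2.2.2.hasSum

theorem HasUnconditionalSchauderBasis.nonempty_unconditionalSchauderBasis [CompleteSpace X]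
    (h : HasUnconditionalSchauderBasis X) : Nonempty (UnconditionalSchauderBasis ℕ ℝ X) := by
  classical
  obtain ⟨e, he⟩ := h
  choose a ha hau using he
  simp only at ha hau
  have hort : ∀ j, a (e j) = Pi.single j 1 := fun j => by
    refine (hau (e j) _ ?_).symm
    convert hasSum_single j fun i hi => ?_ using 1
    · simp
    · simp [hi]
  have he0 : ∀ j, e j ≠ 0 := fun j h0 => by
    have h1 := hort j
    rw [h0, ← hau 0 0 (by simp)] at h1
    simpa using congrFun h1 j
  have hsum_eq : ∀ (u : expansionSpace e) (j), u.1 {j} = a (expansionSum e u) j • e j := by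
    intro u j
    choose c hc using fun j => Submodule.mem_span_singleton.1 (u.2.2.1 j)
    rw [← hau _ c (by simpa only [hc] using hasSum_expansionSum e u), hc]
  have hinj : (expansionSum e).ker = ⊥ := by
    rw [LinearMap.ker_eq_bot']
    intro u hu
    have h0 : ∀ j, u.1 {j} = 0 := fun j => by
      have hu' : expansionSum e u = 0 := hu
      rw [hsum_eq, hu', ← hau 0 0 (by simp)]
      simp
    ext F
    rw [u.2.1]
    simp [h0]
  have hsurj : (expansionSum e).range = ⊤ := by
    rw [LinearMap.range_eq_top]
    intro x
    obtain ⟨M, hM⟩ := (ha x).summable.exists_norm_finset_sum_le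
    let u : lp (fun _ : Finset ℕ => X) ∞ :=
      ⟨fun F => ∑ j ∈ F, a x j • e j, memℓp_infty ⟨M, by rintro _ ⟨F, rfl⟩; exact hM F⟩⟩
    have hu : ∀ F, u F = ∑ j ∈ F, a x j • e j := fun F => rfl
    have hmem : u ∈ expansionSpace e :=
      ⟨fun F => by simp [hu], fun j => Submodule.mem_span_singleton.2 ⟨a x j, by simp [hu]⟩,
        by simpa [hu] using (ha x).summable⟩
    refine ⟨⟨u, hmem⟩, (hasSum_expansionSum e ⟨u, hmem⟩).unique ?_⟩
    simpa [hu] using ha x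
  have : CompleteSpace (expansionSpace e) := (isClosed_expansionSpace e).completeSpace_coe
  let T := ContinuousLinearEquiv.ofBijective (expansionSum e) hinj hsurj
  have hT : ∀ x, expansionSum e (T.symm x) = x := fun x => T.apply_symm_apply x
  have hbound : ∀ x j, ‖a x j‖ ≤ ‖(T.symm : X →L[ℝ] expansionSpace e)‖ / ‖e j‖ * ‖x‖ := by
    intro x j
    rw [div_mul_eq_mul_div, le_div_iff₀ (norm_pos_iff.2 (he0 j)), ← norm_smul]
    have h1 := hsum_eq (T.symm x) j
    rw [hT] at h1
    rw [← h1]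
    exact (lp.norm_apply_le_norm ENNReal.top_ne_zero _ _).trans
      ((T.symm : X →L[ℝ] expansionSpace e).le_opNorm x)
  exact ⟨{
    basis := e
    coord := fun j => LinearMap.mkContinuous
      { toFun := fun x => a x j
        map_add' := fun x y => by
          rw [← hau (x + y) (a x + a y) (by simpa [add_smul] using (ha x).add (ha y))]
          rfl
        map_smul' := fun c x => by
          rw [← hau (c • x) (c • a x) (by simpa [mul_smul] using (ha x).const_smul c)]
          rfl } _ fun x => hbound x j
    ortho := fun i j => by
      convert! congrFun (hort j) i
    expansion := ha }⟩

end CoordinateContinuity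

section SmoothTruncation

variable {X : Type*} [NormedAddCommGroup X] [NormedSpace ℝ X]

/-- A finite sum with multipliers of absolute value at most `C` is controlled by the subsums. -/
theorem norm_sum_smul_le_of_forall_subset {ι : Type*} {v : ι → X} {c : ι → ℝ} {F : Finset ι}
    {C M : ℝ} (hC : 0 ≤ C) (hc : ∀ j ∈ F, |c j| ≤ C) (hM : ∀ F' ⊆ F, ‖∑ j ∈ F', v j‖ ≤ M) :
    ‖∑ j ∈ F, c j • v j‖ ≤ 2 * C * M := by
  classical
  have hM0 : 0 ≤ M := (norm_nonneg _).trans (hM ∅ (Finset.empty_subset F))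
  refine NormedSpace.norm_le_dual_bound ℝ _ (by positivity) fun φ => ?_
  have hφ : ∀ F' ⊆ F, |∑ j ∈ F', φ (v j)| ≤ M * ‖φ‖ := fun F' hF' => by
    rw [← map_sum, mul_comm]
    exact (φ.le_opNorm _).trans (mul_le_mul_of_nonneg_left (hM F' hF') (norm_nonneg φ))
  have hsplit := Finset.sum_filter_add_sum_filter_not F (fun j => 0 ≤ φ (v j)) fun j => |φ (v j)|
  have hpos : ∑ j ∈ F with 0 ≤ φ (v j), |φ (v j)| ≤ M * ‖φ‖ := by
    rw [Finset.sum_congr rfl fun j hj => abs_of_nonneg (Finset.mem_filter.1 hj).2]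
    exact (le_abs_self _).trans (hφ _ (Finset.filter_subset _ _))
  have hneg : ∑ j ∈ F with ¬ 0 ≤ φ (v j), |φ (v j)| ≤ M * ‖φ‖ := by
    rw [Finset.sum_congr rfl fun j hj => abs_of_neg (not_le.1 (Finset.mem_filter.1 hj).2),
      Finset.sum_neg_distrib]
    exact (neg_le_abs _).trans (hφ _ (Finset.filter_subset _ _))
  calc ‖φ (∑ j ∈ F, c j • v j)‖ = |∑ j ∈ F, c j * φ (v j)| := by simp
    _ ≤ ∑ j ∈ F, |c j * φ (v j)| := Finset.abs_sum_le_sum_abs _ _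
    _ ≤ ∑ j ∈ F, C * |φ (v j)| := Finset.sum_le_sum fun j hj => by
        rw [abs_mul]
        exact mul_le_mul_of_nonneg_right (hc j hj) (abs_nonneg _)
    _ = C * ∑ j ∈ F, |φ (v j)| := (Finset.mul_sum _ _ _).symm
    _ ≤ C * (2 * (M * ‖φ‖)) := mul_le_mul_of_nonneg_left (by linarith) hC
    _ = 2 * C * M * ‖φ‖ := by ring

namespace UnconditionalSchauderBasis

variable (b : UnconditionalSchauderBasis ℕ ℝ X)

/-- The tail of the expansion of a vector, starting from the `n`-th term. -/
noncomputable def tail (n : ℕ) : X →L[ℝ] X :=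
  ContinuousLinearMap.id ℝ X - GeneralSchauderBasis.proj b (Finset.range n)

theorem tail_apply (n : ℕ) (x : X) :
    b.tail n x = x - ∑ j ∈ Finset.range n, b.coord j x • b j := by
  simp [tail]

theorem coord_tail {n j : ℕ} (h : n ≤ j) (x : X) : b.coord j (b.tail n x) = b.coord j x := by
  rw [tail_apply, map_sub, map_sum, sub_eq_self]
  refine Finset.sum_eq_zero fun i hi => ?_
  have hij : j ≠ i := by have := Finset.mem_range.1 hi; omega
  simp [b.ortho, hij]

theorem tendsto_tail (x : X) : Tendsto (fun n => b.tail n x) atTop (𝓝 0) := by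
  simp only [tail_apply]
  simpa using (b.expansion x).tendsto_sum_nat.const_sub x

section Complete

variable [CompleteSpace X]

theorem norm_sum_coord_le (F : Finset ℕ) (x : X) :
    ‖∑ j ∈ F, b.coord j x • b j‖ ≤ b.nnnormProjBound * ‖x‖ := by
  rw [← GeneralSchauderBasis.proj_apply]
  exact (GeneralSchauderBasis.proj b F).le_of_opNorm_le (b.norm_proj_le_nnnormProjBound F) x

theorem norm_tail_le (n : ℕ) (x : X) : ‖b.tail n x‖ ≤ (1 + b.nnnormProjBound) * ‖x‖ := by
  rw [tail_apply, add_mul, one_mul]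
  exact (norm_sub_le _ _).trans (add_le_add_right (b.norm_sum_coord_le _ x) _)

/-- The tails of the expansion of `x` are eventually small, uniformly near `x`. -/
theorem eventually_norm_tail_lt (x : X) {r : ℝ} (hr : 0 < r) :
    ∃ N, ∀ᶠ y in 𝓝 x, ∀ n ≥ N, ‖b.tail n y‖ < r := by
  obtain ⟨N, hN⟩ := Metric.tendsto_atTop.1 (b.tendsto_tail x) (r / 2) (by positivity)
  have hA : (0 : ℝ) < 1 + b.nnnormProjBound := by positivity
  refine ⟨N, Metric.eventually_nhds_iff.2 ⟨r / 2 / (1 + b.nnnormProjBound), by positivity,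
    fun y hy n hn => ?_⟩⟩
  have h1 := hN n hn
  rw [dist_zero_right] at h1
  rw [dist_eq_norm, lt_div_iff₀' hA] at hy
  have h2 := (b.norm_tail_le n (y - x)).trans_lt hy
  rw [map_sub] at h2
  have h3 := norm_add_le (b.tail n y - b.tail n x) (b.tail n x)
  rw [sub_add_cancel] at h3
  linarith

/-- Multipliers of the coordinates, bounded by `C` and active only where the tail is bounded by
`r`, produce vectors of norm at most a multiple of `C * r`. -/
theorem norm_sum_smul_coord_le {x : X} {c : ℕ → ℝ} {C r : ℝ} (hC : 0 ≤ C) (hr : 0 ≤ r)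
    (hc : ∀ j, |c j| ≤ C) (hcr : ∀ j, c j ≠ 0 → ‖b.tail j x‖ ≤ r) (F : Finset ℕ) :
    ‖∑ j ∈ F, c j • b.coord j x • b j‖ ≤ 2 * C * (b.nnnormProjBound * r) := by
  rw [← Finset.sum_filter_of_ne (p := fun j => c j ≠ 0)
    fun j _ h h0 => h (by rw [h0, zero_smul])]
  refine norm_sum_smul_le_of_forall_subset hC (fun j _ => hc j) fun F' hF' => ?_
  rcases F'.eq_empty_or_nonempty with rfl | hne
  · simp only [Finset.sum_empty, norm_zero]
    positivity
  have hn := hcr _ (Finset.mem_filter.1 (hF' (F'.min'_mem hne))).2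
  have heq : ∑ j ∈ F', b.coord j x • b j =
      ∑ j ∈ F', b.coord j (b.tail (F'.min' hne) x) • b j :=
    Finset.sum_congr rfl fun j hj => by rw [b.coord_tail (F'.min'_le j hj) x]
  rw [heq]
  exact (b.norm_sum_coord_le F' _).trans (mul_le_mul_of_nonneg_left hn (NNReal.coe_nonneg _))

end Complete

/-- Each term of the expansion of `x` is multiplied by the value of `h` at the tail starting
from it, rescaled by `l`. -/
noncomputable def truncation (h : X → ℝ) (l : ℝ) (x : X) : X :=
  ∑' j, h (l⁻¹ • b.tail j x) • b.coord j x • b j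

section Truncation

variable [CompleteSpace X] {h : X → ℝ} {r R L l : ℝ}

/-- Locally, the truncation is a finite sum. -/
theorem truncation_eventually_eq (hr : 0 < r) (h0 : ∀ x, ‖x‖ < r → h x = 0) (hl : 0 < l)
    (x : X) : ∃ N, ∀ᶠ y in 𝓝 x, b.truncation h l y =
      ∑ j ∈ Finset.range N, (h (l⁻¹ • b.tail j y) * b.coord j y) • b j := by
  obtain ⟨N, hN⟩ := b.eventually_norm_tail_lt x (mul_pos hl hr)
  refine ⟨N, hN.mono fun y hy => ?_⟩
  rw [truncation, tsum_eq_sum (s := Finset.range N) fun j hj => ?_]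
  · simp only [smul_smul]
  · rw [h0, zero_smul]
    rw [norm_smul, norm_inv, Real.norm_of_nonneg hl.le, inv_mul_lt_iff₀ hl]
    exact hy j (by simpa using hj)

theorem hasSum_truncation (hr : 0 < r) (h0 : ∀ x, ‖x‖ < r → h x = 0) (hl : 0 < l) (x : X) :
    HasSum (fun j => h (l⁻¹ • b.tail j x) • b.coord j x • b j) (b.truncation h l x) := by
  obtain ⟨N, hN⟩ := b.eventually_norm_tail_lt x (mul_pos hl hr)
  refine (summable_of_ne_finset_zero (s := Finset.range N) fun j hj => ?_).hasSum
  rw [h0, zero_smul]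
  rw [norm_smul, norm_inv, Real.norm_of_nonneg hl.le, inv_mul_lt_iff₀ hl]
  exact hN.self_of_nhds j (by simpa using hj)

theorem norm_sub_truncation_le (hr : 0 < r) (h0 : ∀ x, ‖x‖ < r → h x = 0) (hl : 0 < l)
    (hh : ∀ x, h x ∈ Set.Icc 0 1) (hR : 0 ≤ R) (h1 : ∀ x, R < ‖x‖ → h x = 1) (x : X) :
    ‖x - b.truncation h l x‖ ≤ 2 * (b.nnnormProjBound * (R * l)) := by
  have hs := (b.expansion x).sub (b.hasSum_truncation hr h0 hl x)
  refine hs.norm_le_of_forall_finset fun F => ?_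
  have := b.norm_sum_smul_coord_le (x := x) (c := fun j => 1 - h (l⁻¹ • b.tail j x)) zero_le_one
    (by positivity : 0 ≤ R * l) (fun j => ?_) (fun j hj => ?_) F
  · simpa [sub_smul] using this
  · obtain ⟨h2, h3⟩ := hh (l⁻¹ • b.tail j x)
    rw [abs_le]
    constructor <;> linarith
  · by_contra! hlt
    refine hj (sub_eq_zero.2 (h1 _ ?_).symm)
    rwa [norm_smul, norm_inv, Real.norm_of_nonneg hl.le, lt_inv_mul_iff₀ hl, mul_comm]

theorem norm_truncation_sub_le (hr : 0 < r) (h0 : ∀ x, ‖x‖ < r → h x = 0) (hl : 0 < l)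
    (hh : ∀ x, h x ∈ Set.Icc 0 1) (hR : 0 ≤ R) (h1 : ∀ x, R < ‖x‖ → h x = 1) (hL : 0 ≤ L)
    (hhL : ∀ x y, |h x - h y| ≤ L * ‖x - y‖) (x y : X) :
    ‖b.truncation h l x - b.truncation h l y‖ ≤
      (1 + 4 * (b.nnnormProjBound * R) + 2 * (b.nnnormProjBound * (1 + b.nnnormProjBound)) +
        2 * (L * (1 + b.nnnormProjBound)) * (b.nnnormProjBound * (R + (1 + b.nnnormProjBound)))) *
          ‖x - y‖ := by
  set B : ℝ := (b.nnnormProjBound : ℝ) with hBdef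
  have hB : 0 ≤ B := NNReal.coe_nonneg _
  set d := ‖x - y‖ with hd
  have hd0 : 0 ≤ d := norm_nonneg _
  have hnn : 0 ≤ 2 * (L * (1 + B)) * (B * (R + (1 + B))) := by positivity
  rcases le_or_gt l d with hld | hld
  · have hx := b.norm_sub_truncation_le hr h0 hl hh hR h1 x
    have hy := b.norm_sub_truncation_le hr h0 hl hh hR h1 y
    have h2 : ‖b.truncation h l x - b.truncation h l y‖ ≤
        d + ‖x - b.truncation h l x‖ + ‖y - b.truncation h l y‖ := by
      rw [show b.truncation h l x - b.truncation h l y =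
        ((x - y) - (x - b.truncation h l x)) + (y - b.truncation h l y) by abel]
      exact (norm_add_le _ _).trans (add_le_add_left (norm_sub_le _ _) _)
    have h3 : B * R * l ≤ B * R * d := mul_le_mul_of_nonneg_left hld (by positivity)
    have h4 : 0 ≤ B * (1 + B) * d := by positivity
    have h5 := mul_nonneg hnn hd0
    change _ ≤ 2 * (B * (R * l)) at hx hy
    linarith
  · have hs := (b.hasSum_truncation hr h0 hl x).sub (b.hasSum_truncation hr h0 hl y)
    have hdiff : ∀ j, |h (l⁻¹ • b.tail j x) - h (l⁻¹ • b.tail j y)| ≤ L * (1 + B) * (l⁻¹ * d) := by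
      intro j
      refine (hhL _ _).trans ?_
      rw [← smul_sub, ← map_sub, norm_smul, norm_inv, Real.norm_of_nonneg hl.le, mul_assoc L,
        mul_left_comm (1 + B)]
      exact mul_le_mul_of_nonneg_left (mul_le_mul_of_nonneg_left (b.norm_tail_le j (x - y))
        (inv_nonneg.2 hl.le)) hL
    have h2 : ‖b.truncation h l x - b.truncation h l y‖ ≤
        2 * 1 * (B * ((1 + B) * d)) +
          2 * (L * (1 + B) * (l⁻¹ * d)) * (B * (R * l + (1 + B) * l)) := by
      refine hs.norm_le_of_forall_finset fun F => ?_
      have hF1 := b.norm_sum_smul_coord_le (x := x - y) (c := fun j => h (l⁻¹ • b.tail j x))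
        zero_le_one (by positivity : 0 ≤ (1 + B) * d)
        (fun j => abs_le.2 ⟨by linarith [(hh (l⁻¹ • b.tail j x)).1], (hh _).2⟩)
        (fun j _ => b.norm_tail_le j (x - y)) F
      have hF2 := b.norm_sum_smul_coord_le (x := y)
        (c := fun j => h (l⁻¹ • b.tail j x) - h (l⁻¹ • b.tail j y))
        (by positivity) (by positivity : 0 ≤ R * l + (1 + B) * l) hdiff (fun j hj => ?_) F
      · refine le_of_eq_of_le ?_ ((norm_add_le _ _).trans (add_le_add hF1 hF2))
        rw [← Finset.sum_add_distrib]
        congr 1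
        refine Finset.sum_congr rfl fun j _ => ?_
        rw [map_sub, sub_smul, sub_smul, smul_sub]
        abel
      · have hone : ∀ z, R * l < ‖b.tail j z‖ → h (l⁻¹ • b.tail j z) = 1 := fun z hz => by
          refine h1 _ ?_
          rwa [norm_smul, norm_inv, Real.norm_of_nonneg hl.le, lt_inv_mul_iff₀ hl, mul_comm]
        have hBl : 0 ≤ (1 + B) * l := by positivity
        by_contra! hlt
        refine hj ?_
        have h3 := (b.norm_tail_le j (x - y)).trans
          (mul_le_mul_of_nonneg_left hld.le (by positivity : 0 ≤ 1 + B))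
        rw [map_sub] at h3
        have h4 := norm_sub_norm_le (b.tail j y) (b.tail j x)
        rw [norm_sub_rev] at h4
        rw [hone x (by linarith), hone y (by linarith), sub_self]
    have h3 : 2 * (L * (1 + B) * (l⁻¹ * d)) * (B * (R * l + (1 + B) * l)) =
        2 * (L * (1 + B)) * (B * (R + (1 + B))) * d := by
      field_simp
    have h4 : 0 ≤ B * R * d := by positivity
    rw [h3] at h2
    linarith

end Truncation

end UnconditionalSchauderBasis

end SmoothTruncation

section LineMollification

open MeasureTheory

/-- A smooth bump on the real line supported in the unit ball. -/
noncomputable def unitBump : ContDiffBump (0 : ℝ) := ⟨1 / 2, 1, by norm_num, by norm_num⟩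

theorem unitBump_normed_eq_zero {s : ℝ} (hs : 1 < ‖s‖) : unitBump.normed volume s = 0 := by
  by_contra h
  have h1 : s ∈ Metric.ball (0 : ℝ) 1 := by
    rw [← show unitBump.rOut = 1 from rfl, ← unitBump.support_normed_eq (μ := volume)]
    exact h
  rw [mem_ball_zero_iff] at h1
  exact lt_asymm hs h1

variable {X Z : Type*} [NormedAddCommGroup X] [NormedSpace ℝ X] [NormedAddCommGroup Z]
  [NormedSpace ℝ Z]

theorem integrable_unitBump_smul {u : ℝ → Z} (hu : Continuous u) :
    Integrable fun s => unitBump.normed volume s • u s :=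
  (unitBump.continuous_normed.smul hu).integrable_of_hasCompactSupport
    unitBump.hasCompactSupport_normed.smul_right

theorem norm_integral_unitBump_smul_sub_le {u v : ℝ → Z} (hu : Continuous u) (hv : Continuous v)
    {M : ℝ} (h : ∀ s, ‖s‖ ≤ 1 → ‖u s - v s‖ ≤ M) :
    ‖(∫ s, unitBump.normed volume s • u s) - ∫ s, unitBump.normed volume s • v s‖ ≤ M := by
  rw [← integral_sub (integrable_unitBump_smul hu) (integrable_unitBump_smul hv)]
  calc _ ≤ ∫ s, unitBump.normed volume s * M := by
        refine norm_integral_le_of_norm_le (unitBump.integrable_normed.mul_const M)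
          (Eventually.of_forall fun s => ?_)
        rcases le_or_gt ‖s‖ 1 with hs | hs
        · rw [← smul_sub, norm_smul, Real.norm_of_nonneg (unitBump.nonneg_normed s)]
          exact mul_le_mul_of_nonneg_left (h s hs) (unitBump.nonneg_normed s)
        · simp [unitBump_normed_eq_zero hs]
    _ = M := by rw [integral_mul_const, unitBump.integral_normed, one_mul]

/-- Mollification of `g` along the segment spanned by `a`. -/
noncomputable def lineMollify (a : X) (g : X → Z) (x : X) : Z :=
  ∫ s : ℝ, unitBump.normed volume s • g (x - s • a)

theorem norm_lineMollify_sub_lineMollify_le (a : X) {g h : X → Z} (hg : Continuous g)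
    (hh : Continuous h) {M : ℝ} (hM : ∀ x, ‖g x - h x‖ ≤ M) (x : X) :
    ‖lineMollify a g x - lineMollify a h x‖ ≤ M :=
  norm_integral_unitBump_smul_sub_le (by fun_prop) (by fun_prop) fun _ _ => hM _

theorem LipschitzWith.lineMollify (a : X) {K : NNReal} {g : X → Z} (hg : LipschitzWith K g) :
    LipschitzWith K (lineMollify a g) := by
  have hc := hg.continuous
  refine LipschitzWith.of_dist_le_mul fun x y => ?_
  rw [dist_eq_norm]
  refine norm_integral_unitBump_smul_sub_le (by fun_prop) (by fun_prop) fun s _ => ?_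
  rw [← dist_eq_norm]
  simpa using hg.dist_le_mul (x - s • a) (y - s • a)

theorem LipschitzWith.norm_lineMollify_sub_le [CompleteSpace Z] (a : X) {K : NNReal} {g : X → Z}
    (hg : LipschitzWith K g) (x : X) : ‖_root_.lineMollify a g x - g x‖ ≤ K * ‖a‖ := by
  have hc := hg.continuous
  rw [← unitBump.integral_normed_smul (μ := volume) (g x)]
  refine norm_integral_unitBump_smul_sub_le (by fun_prop) (by fun_prop) fun s hs => ?_
  rw [← dist_eq_norm]
  refine (hg.dist_le_mul _ _).trans (mul_le_mul_of_nonneg_left ?_ K.2)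
  rw [dist_eq_norm, sub_sub_cancel_left, norm_neg, norm_smul]
  exact mul_le_of_le_one_left (norm_nonneg a) hs

/-- `m` successive mollifications of `f`, along `a (N + m - 1)`, …, `a (N + 1)`, `a N`. -/
noncomputable def iterLineMollify (a : ℕ → X) (f : X → Z) : ℕ → ℕ → X → Z
  | _, 0 => f
  | N, m + 1 => lineMollify (a N) (iterLineMollify a f (N + 1) m)

theorem LipschitzWith.iterLineMollify (a : ℕ → X) {K : NNReal} {f : X → Z} (hf : LipschitzWith K f)
    (N m : ℕ) : LipschitzWith K (iterLineMollify a f N m) := by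
  induction m generalizing N with
  | zero => exact hf
  | succ m ih => exact (ih (N + 1)).lineMollify (a N)

theorem LipschitzWith.norm_iterLineMollify_succ_sub_le [CompleteSpace Z] (a : ℕ → X) {K : NNReal}
    {f : X → Z} (hf : LipschitzWith K f) (N m : ℕ) (x : X) :
    ‖_root_.iterLineMollify a f N (m + 1) x - _root_.iterLineMollify a f N m x‖ ≤
      K * ‖a (N + m)‖ := by
  induction m generalizing N x with
  | zero => exact hf.norm_lineMollify_sub_le (a N) x
  | succ m ih =>
    refine norm_lineMollify_sub_lineMollify_le (a N) (hf.iterLineMollify a _ _).continuous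
      (hf.iterLineMollify a _ _).continuous (fun y => ?_) x
    rw [← add_assoc, add_right_comm]
    exact ih (N + 1) y

/-- Successive mollifications along a rapidly decreasing sequence of directions converge. -/
theorem LipschitzWith.exists_eq_lineMollify [CompleteSpace Z] {a : ℕ → X} {K : NNReal} {f : X → Z}
    (hf : LipschitzWith K f) {ε : ℝ} (hε : 0 ≤ ε) (ha : ∀ j, K * ‖a j‖ ≤ ε / 2 / 2 ^ j) :
    ∃ G : ℕ → X → Z, (∀ N, LipschitzWith K (G N)) ∧ (∀ x, ‖f x - G 0 x‖ ≤ ε) ∧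
      ∀ N, G N = _root_.lineMollify (a N) (G (N + 1)) := by
  have hd : ∀ N x m, dist (_root_.iterLineMollify a f N m x)
      (_root_.iterLineMollify a f N (m + 1) x) ≤ ε / 2 / 2 ^ m := fun N x m => by
    rw [dist_comm, dist_eq_norm]
    refine ((hf.norm_iterLineMollify_succ_sub_le a N m x).trans (ha _)).trans ?_
    gcongr
    · norm_num
    · omega
  choose G hG using fun N x => cauchySeq_tendsto_of_complete (cauchySeq_of_le_geometric_two (hd N x))
  have hGd : ∀ N m x, dist (_root_.iterLineMollify a f N m x) (G N x) ≤ ε / 2 ^ m := fun N m x =>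
    dist_le_of_le_geometric_two_of_tendsto (hd N x) (hG N x) m
  have hGL : ∀ N, LipschitzWith K (G N) := fun N =>
    LipschitzWith.of_dist_le_mul fun x y =>
      le_of_tendsto ((hG N x).dist (hG N y)) (Eventually.of_forall fun m =>
        (hf.iterLineMollify a N m).dist_le_mul x y)
  refine ⟨G, hGL, fun x => ?_, fun N => funext fun x => ?_⟩
  · simpa [dist_eq_norm, _root_.iterLineMollify] using hGd 0 0 x
  · refine tendsto_nhds_unique ((tendsto_add_atTop_iff_nat 1).2 (hG N x)) ?_
    rw [tendsto_iff_norm_sub_tendsto_zero]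
    have h0 : Tendsto (fun m : ℕ => ε / 2 ^ m) atTop (𝓝 0) := by
      simpa [div_eq_mul_inv] using
        (tendsto_pow_atTop_nhds_zero_of_lt_one (r := (2 : ℝ)⁻¹) (by norm_num)
          (by norm_num)).const_mul ε
    refine squeeze_zero (fun _ => norm_nonneg _) (fun m => ?_) h0
    refine norm_lineMollify_sub_lineMollify_le (a N) (hf.iterLineMollify a _ _).continuous
      (hGL _).continuous (fun y => ?_) x
    rw [← dist_eq_norm]
    exact hGd (N + 1) m y

/-- Finitely many successive mollifications amount to one mollification with a smooth kernel on
a finite-dimensional space. -/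
theorem exists_kernel_of_eq_lineMollify [CompleteSpace Z] {a : ℕ → X} {G : ℕ → X → Z}
    (hG : ∀ N, Continuous (G N)) (hrec : ∀ N, G N = lineMollify (a N) (G (N + 1))) (N : ℕ) :
    ∃ k : (Fin N → ℝ) → ℝ, ContDiff ℝ ((⊤ : ℕ∞) : WithTop ℕ∞) k ∧ (∀ t, 1 < ‖t‖ → k t = 0) ∧
      ∀ x, G 0 x = ∫ t, k t • G N (x - ∑ i, t i • a i) := by
  induction N with
  | zero =>
    refine ⟨fun _ => 1, contDiff_const, fun t ht => ?_, fun x => ?_⟩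
    · rw [Subsingleton.elim t 0, norm_zero] at ht
      exact absurd ht (by norm_num)
    · simp [measureReal_def, volume_pi]
  | succ N ih =>
    obtain ⟨k, hk, hk0, hkG⟩ := ih
    refine ⟨fun t => unitBump.normed volume (t (Fin.last N)) * k fun i => t i.castSucc,
      ?_, fun t ht => ?_, fun x => ?_⟩
    · have h1 : ContDiff ℝ ((⊤ : ℕ∞) : WithTop ℕ∞) fun t : Fin (N + 1) → ℝ => t (Fin.last N) :=
        contDiff_apply ℝ ℝ _
      have h2 : ContDiff ℝ ((⊤ : ℕ∞) : WithTop ℕ∞)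
          fun (t : Fin (N + 1) → ℝ) (i : Fin N) => t i.castSucc :=
        contDiff_pi.2 fun i => contDiff_apply ℝ ℝ _
      exact (unitBump.contDiff_normed.comp h1).mul (hk.comp h2)
    · dsimp only
      by_cases h1 : ‖t (Fin.last N)‖ ≤ 1
      · rw [hk0 _ ?_, mul_zero]
        by_contra h2
        refine ht.not_ge ((pi_norm_le_iff_of_nonneg zero_le_one).2 (Fin.forall_fin_succ'.2 ⟨?_, h1⟩))
        exact (pi_norm_le_iff_of_nonneg zero_le_one).1 (not_lt.1 h2)
      · rw [unitBump_normed_eq_zero (not_le.1 h1), zero_mul]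
    · have hc := hG (N + 1)
      have hkc := hk.continuous
      have hbc := unitBump.continuous_normed (μ := volume)
      let F : ℝ × (Fin N → ℝ) → Z := fun q => (unitBump.normed volume q.1 * k q.2) •
        G (N + 1) (x - ((∑ i, q.2 i • a i) + q.1 • a N))
      have hF : Integrable F := by
        refine Continuous.integrable_of_hasCompactSupport (by fun_prop)
          (HasCompactSupport.intro (isCompact_closedBall 0 1) fun q hq => ?_)
        rw [mem_closedBall_zero_iff, Prod.norm_def, max_le_iff, not_and_or] at hq
        rcases hq with hq | hq
        · simp [F, unitBump_normed_eq_zero (not_le.1 hq)]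
        · simp [F, hk0 _ (not_le.1 hq)]
      have hmp := volume_preserving_piFinSuccAbove (fun _ : Fin (N + 1) => ℝ) (Fin.last N)
      calc G 0 x = ∫ t, k t • G N (x - ∑ i, t i • a i) := hkG x
        _ = ∫ t, ∫ s, F (s, t) := by
          refine integral_congr_ae (Eventually.of_forall fun t => ?_)
          simp only [hrec N, lineMollify, F]
          rw [← integral_smul]
          refine integral_congr_ae (Eventually.of_forall fun s => ?_)
          simp only [smul_smul, mul_comm (k t), sub_sub]
        _ = ∫ q, F q := (integral_prod_symm F hF).symm
        _ = ∫ t, F (MeasurableEquiv.piFinSuccAbove (fun _ => ℝ) (Fin.last N) t) :=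
          (hmp.integral_comp' F).symm
        _ = _ := by
          refine integral_congr_ae (Eventually.of_forall fun t => ?_)
          simp [F, MeasurableEquiv.piFinSuccAbove, Fin.insertNthEquiv, Fin.sum_univ_castSucc,
            Fin.init]
          rfl

theorem contDiff_of_eq_lineMollify [CompleteSpace Z] {a : ℕ → X} {G : ℕ → X → Z}
    (hG : ∀ N, Continuous (G N)) (hrec : ∀ N, G N = lineMollify (a N) (G (N + 1))) (N : ℕ) :
    ContDiff ℝ ((⊤ : ℕ∞) : WithTop ℕ∞) fun c : Fin N → ℝ => G 0 (∑ i, c i • a i) := by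
  obtain ⟨k, hk, hk0, hkG⟩ := exists_kernel_of_eq_lineMollify hG hrec N
  have hcs : HasCompactSupport k :=
    HasCompactSupport.intro (isCompact_closedBall 0 1) fun t ht =>
      hk0 t (not_le.1 fun h => ht (mem_closedBall_zero_iff.2 h))
  have hc := hG N
  have hcont : Continuous fun v : Fin N → ℝ => G N (∑ i, v i • a i) := by fun_prop
  convert hcs.contDiff_convolution_left (ContinuousLinearMap.lsmul ℝ ℝ) hk
    (hcont.locallyIntegrable (μ := volume)) using 1
  ext c
  simp [hkG, convolution, sub_smul]

/-- A Lipschitz map can be uniformly approximated, without increasing its Lipschitz constant, by a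
map that is smooth along the span of the first `N` vectors of a given sequence, for every `N`. -/
theorem LipschitzWith.exists_contDiff_span_approx [CompleteSpace Z] {K : NNReal} {f : X → Z}
    (hf : LipschitzWith K f) (e : ℕ → X) {ε : ℝ} (hε : 0 < ε) :
    ∃ G : X → Z, LipschitzWith K G ∧ (∀ x, ‖f x - G x‖ ≤ ε) ∧
      ∀ N, ContDiff ℝ ((⊤ : ℕ∞) : WithTop ℕ∞) fun c : Fin N → ℝ => G (∑ i, c i • e i) := by
  have hD : ∀ j, 0 < (K + 1) * (1 + ‖e j‖) := fun j => by positivity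
  let δ : ℕ → ℝ := fun j => ε / 2 / 2 ^ j / ((K + 1) * (1 + ‖e j‖))
  have hδ : ∀ j, 0 < δ j := fun j => div_pos (by positivity) (hD j)
  obtain ⟨G, hGL, hGf, hrec⟩ := hf.exists_eq_lineMollify (a := fun j => δ j • e j) hε.le fun j => by
    have h1 : (K : ℝ) * ‖e j‖ ≤ (K + 1) * (1 + ‖e j‖) := by
      nlinarith [K.2, norm_nonneg (e j), NNReal.coe_nonneg K]
    calc (K : ℝ) * ‖δ j • e j‖ = δ j * (K * ‖e j‖) := by
          rw [norm_smul, Real.norm_of_nonneg (hδ j).le]; ring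
      _ ≤ δ j * ((K + 1) * (1 + ‖e j‖)) := mul_le_mul_of_nonneg_left h1 (hδ j).le
      _ = _ := div_mul_cancel₀ _ (hD j).ne'
  refine ⟨G 0, hGL 0, hGf, fun N => ?_⟩
  have h1 : ContDiff ℝ ((⊤ : ℕ∞) : WithTop ℕ∞) fun (c : Fin N → ℝ) (i : Fin N) => c i / δ i :=
    contDiff_pi.2 fun i => (contDiff_apply ℝ ℝ i).div_const _
  convert (contDiff_of_eq_lineMollify (fun N => (hGL N).continuous) hrec N).comp h1 using 1
  ext c
  simp [smul_smul, div_mul_cancel₀ _ (hδ _).ne']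

end LineMollification

/-- A Lipschitz `C^p`-smooth bump function yields a Lipschitz `C^p`-smooth function with values in
`[0, 1]` that vanishes near the origin and equals `1` far from it. -/
theorem HasLipschitzSmoothBump.exists_cutoff {X : Type*} [NormedAddCommGroup X] [NormedSpace ℝ X]
    {p : ℕ∞} (hb : HasLipschitzSmoothBump X p) :
    ∃ (h : X → ℝ) (r R L : ℝ), 0 < r ∧ 0 ≤ R ∧ 0 ≤ L ∧ ContDiff ℝ p h ∧
      (∀ x, h x ∈ Set.Icc 0 1) ∧ (∀ x, ‖x‖ < r → h x = 0) ∧ (∀ x, R < ‖x‖ → h x = 1) ∧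
      ∀ x y, |h x - h y| ≤ L * ‖x - y‖ := by
  obtain ⟨b, hbs, ⟨C, hC⟩, hbd, x₀, hx₀⟩ := hb
  have hx₀ : b x₀ ≠ 0 := hx₀
  let χ : ContDiffBump (1 : ℝ) := ⟨1 / 4, 1 / 2, by norm_num, by norm_num⟩
  obtain ⟨M, hM⟩ := ContDiff.lipschitzWith_of_hasCompactSupport (𝕂 := ℝ) χ.hasCompactSupport
    (χ.contDiff (n := 1)) one_ne_zero
  have hg : Continuous fun x => b (x₀ + x) / b x₀ :=
    (hC.continuous.comp (continuous_const.add continuous_id)).div_const _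
  have hmem : (fun x => b (x₀ + x) / b x₀) ⁻¹' Metric.ball 1 (1 / 4) ∈ 𝓝 (0 : X) :=
    hg.continuousAt.preimage_mem_nhds
      (by simpa [hx₀] using Metric.ball_mem_nhds (1 : ℝ) (by norm_num : (0 : ℝ) < 1 / 4))
  obtain ⟨r, hr, hball⟩ := Metric.mem_nhds_iff.1 hmem
  obtain ⟨R, hR⟩ := hbd.exists_norm_le
  refine ⟨fun x => 1 - χ (b (x₀ + x) / b x₀), r, max (R + ‖x₀‖) 0, M * (C * |b x₀|⁻¹), hr,
    le_max_right _ _, by positivity, ?_, fun x => ⟨?_, ?_⟩, fun x hx => ?_, fun x hx => ?_,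
    fun x y => ?_⟩
  · exact contDiff_const.sub
      (χ.contDiff.comp ((hbs.comp (contDiff_const.add contDiff_id)).div_const _))
  · exact sub_nonneg.2 χ.le_one
  · exact sub_le_self _ χ.nonneg
  · have h1 : b (x₀ + x) / b x₀ ∈ Metric.ball 1 (1 / 4) := hball (mem_ball_zero_iff.2 hx)
    dsimp only
    rw [χ.one_of_mem_closedBall (Metric.ball_subset_closedBall h1), sub_self]
  · have h1 : b (x₀ + x) = 0 := by
      by_contra hne
      have h2 := hR _ (subset_closure hne)
      have h3 := norm_sub_le (x₀ + x) x₀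
      rw [add_sub_cancel_left] at h3
      linarith [(le_max_left (R + ‖x₀‖) 0).trans_lt hx]
    dsimp only
    rw [h1, zero_div, χ.zero_of_le_dist (by norm_num [χ]), sub_zero]
  · have h1 := hM.dist_le_mul (b (x₀ + y) / b x₀) (b (x₀ + x) / b x₀)
    have h2 := hC.dist_le_mul (x₀ + x) (x₀ + y)
    rw [Real.dist_eq, Real.dist_eq, ← sub_div, abs_div, abs_sub_comm (b _)] at h1
    rw [Real.dist_eq, dist_add_left, dist_eq_norm] at h2
    rw [sub_sub_sub_cancel_left]
    refine h1.trans ?_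
    rw [mul_assoc, mul_assoc]
    refine mul_le_mul_of_nonneg_left ?_ M.2
    rw [div_eq_mul_inv, mul_left_comm, mul_comm]
    exact mul_le_mul_of_nonneg_left h2 (by positivity)

/-- Theorem 1 (second part): there is a constant `C₀ > 1` depending only on `X`
such that every `η`-Lipschitz map `f : X → Z` into a Banach space `Z` can be
`ε`-approximated by a `C^p`-smooth, `C₀η`-Lipschitz map `K : X → Z`. -/
theorem smooth_lipschitz_approx_of_lipschitz_vector_valued
    {X : Type*} [NormedAddCommGroup X] [NormedSpace ℝ X] [CompleteSpace X]
    (p : ℕ∞) (hp : 1 ≤ p)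
    (hbasis : HasUnconditionalSchauderBasis X)
    (hbump : HasLipschitzSmoothBump X p) :
    ∃ C₀ : ℝ, 1 < C₀ ∧
      ∀ (Z : Type u) (_ : NormedAddCommGroup Z) (_ : NormedSpace ℝ Z) (_ : CompleteSpace Z),
        ∀ (f : X → Z) (η : ℝ), 0 ≤ η → (∀ x x' : X, ‖f x - f x'‖ ≤ η * ‖x - x'‖) →
          ∀ ε : ℝ, 0 < ε →
            ∃ K : X → Z, ContDiff ℝ p K ∧ (∀ x : X, ‖f x - K x‖ < ε) ∧
              ∀ x x' : X, ‖K x - K x'‖ ≤ C₀ * η * ‖x - x'‖ := by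
  obtain ⟨b⟩ := hbasis.nonempty_unconditionalSchauderBasis
  obtain ⟨h, r, R, L, hr, hR, hL, hhp, hh, h0, h1, hhL⟩ := hbump.exists_cutoff
  set B : ℝ := (b.nnnormProjBound : ℝ) with hBdef
  have hB : 0 ≤ B := NNReal.coe_nonneg _
  refine ⟨1 + 4 * (B * R) + 2 * (B * (1 + B)) +
    2 * (L * (1 + B)) * (B * (R + (1 + B))) + 1, ?_, ?_⟩
  · have : 0 ≤ 4 * (B * R) + 2 * (B * (1 + B)) + 2 * (L * (1 + B)) * (B * (R + (1 + B))) := by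
      positivity
    linarith
  intro Z _ _ _ f η hη hf ε hε
  have hfL : LipschitzWith ⟨η, hη⟩ f := LipschitzWith.of_dist_le_mul fun x y => by
    rw [dist_eq_norm, dist_eq_norm]
    exact hf x y
  obtain ⟨G, hGL, hfG, hGs⟩ := hfL.exists_contDiff_span_approx b (half_pos hε)
  have hGL' : ∀ x y, ‖G x - G y‖ ≤ η * ‖x - y‖ := fun x y => by
    rw [← dist_eq_norm, ← dist_eq_norm]
    exact hGL.dist_le_mul x y
  have hD : 0 ≤ η * (2 * (B * R)) := by positivity
  let l : ℝ := ε / 4 / (η * (2 * (B * R)) + 1)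
  have hl : 0 < l := by positivity
  refine ⟨fun x => G (b.truncation h l x), ?_, fun x => ?_, fun x y => ?_⟩
  · refine contDiff_iff_contDiffAt.2 fun x => ?_
    obtain ⟨N, hN⟩ := b.truncation_eventually_eq hr h0 hl x
    have hc : ContDiff ℝ p fun (y : X) (i : Fin N) => h (l⁻¹ • b.tail i y) * b.coord i y :=
      contDiff_pi.2 fun i =>
        (hhp.comp ((b.tail i).contDiff.const_smul l⁻¹)).mul (b.coord i).contDiff
    have hs := ((hGs N).of_le (by exact_mod_cast le_top)).comp hc
    refine hs.contDiffAt.congr_of_eventuallyEq (hN.mono fun y hy => ?_)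
    simp only [hy, comp_apply, Finset.sum_range]
  · have h2 := b.norm_sub_truncation_le hr h0 hl hh hR h1 x
    have h3 : η * (2 * (B * (R * l))) ≤ ε / 4 := by
      have h4 : (η * (2 * (B * R)) + 1) * l = ε / 4 := mul_div_cancel₀ _ (by positivity)
      linarith
    have h5 := (hf x (b.truncation h l x)).trans (mul_le_mul_of_nonneg_left h2 hη)
    have h6 := hfG (b.truncation h l x)
    have h7 := norm_sub_le_norm_sub_add_norm_sub (f x) (f (b.truncation h l x))
      (G (b.truncation h l x))
    linarith
  · refine (hGL' _ _).trans ((mul_le_mul_of_nonneg_left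
      (b.norm_truncation_sub_le hr h0 hl hh hR h1 hL hhL x y) hη).trans ?_)
    have := mul_nonneg hη (norm_nonneg (x - y))
    linarith
end

section
/- Let X be a Banach space with an unconditional Schauder basis. The following are equivalent: (1) X admits a Lipschitz, C^p-smooth bump function; (2) for every convex subset Y ⊆ X, every uniformly continuous map f : Y → ℝ, and every ε > 0, there exists a Lipschitz, C^p-smooth map K : X → ℝ with |f − K| < ε on Y; (3) for every subset Y ⊆ X, every Lipschitz function f : Y → ℝ, and every ε > 0, there exists a Lipschitz, C^p-smooth map K : X → ℝ with |f − K| < ε on Y; (4) for every Banach space Z, every Lipschitz map f : X → Z, and every ε > 0, there exists a Lipschitz, C^p-smooth map K : X → Z with ‖f − K‖ < ε on X. -/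
open Function Bornology

open Filter Topology MeasureTheory

section Basis

/-- The finite subsums of a summable family are bounded. -/
theorem exists_norm_finset_sum_le_of_summable {ι X : Type*} [NormedAddCommGroup X] {v : ι → X} (hv : Summable v) :
    ∃ M : ℝ, ∀ F : Finset ι, ‖∑ j ∈ F, v j‖ ≤ M := by
  classical
  obtain ⟨x, hx⟩ := hv
  obtain ⟨s, hs⟩ := cauchySeq_finset_iff_vanishing_norm.1 hx.cauchySeq 1 one_pos
  refine ⟨1 + ∑ j ∈ s, ‖v j‖, fun F => ?_⟩
  rw [← Finset.sum_sdiff (Finset.inter_subset_left (s₁ := F) (s₂ := s))]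
  refine (norm_add_le _ _).trans (add_le_add (hs _ ?_).le ?_)
  · rw [Finset.sdiff_inter_self_left]
    exact Finset.sdiff_disjoint
  · exact (norm_sum_le _ _).trans
      (Finset.sum_le_sum_of_subset_of_nonneg Finset.inter_subset_right fun _ _ _ => norm_nonneg _)

theorem sum_abs_le_two_mul_of_abs_sum_le {ι : Type*} {u : ι → ℝ} {M : ℝ}
    (h : ∀ F : Finset ι, |∑ j ∈ F, u j| ≤ M) (F : Finset ι) : ∑ j ∈ F, |u j| ≤ 2 * M := by
  classical
  rw [← Finset.sum_filter_add_sum_filter_not F (fun j => 0 ≤ u j)]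
  have h1 : ∑ j ∈ F with 0 ≤ u j, |u j| = ∑ j ∈ F with 0 ≤ u j, u j :=
    Finset.sum_congr rfl fun j hj => abs_of_nonneg (Finset.mem_filter.1 hj).2
  have h2 : ∑ j ∈ F with ¬ 0 ≤ u j, |u j| = -∑ j ∈ F with ¬ 0 ≤ u j, u j := by
    rw [← Finset.sum_neg_distrib]
    exact Finset.sum_congr rfl fun j hj => abs_of_neg (not_le.1 (Finset.mem_filter.1 hj).2)
  rw [h1, h2]
  linarith [(abs_le.1 (h (F.filter fun j => 0 ≤ u j))).2,
    (abs_le.1 (h (F.filter fun j => ¬ 0 ≤ u j))).1]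

variable {X : Type*} [NormedAddCommGroup X] [NormedSpace ℝ X]

/-- Bounded multipliers act boundedly on families with bounded finite subsums. -/
theorem norm_sum_smul_le_of_norm_sum_le {ι : Type*} [Nonempty ι] {v : ι → X} {M : ℝ}
    (h : ∀ F : Finset ι, ‖∑ j ∈ F, v j‖ ≤ M) {c : ι → ℝ} {A : ℝ} (hc : ∀ j, |c j| ≤ A)
    (F : Finset ι) : ‖∑ j ∈ F, c j • v j‖ ≤ 2 * A * M := by
  have hM : 0 ≤ M := (norm_nonneg _).trans (h ∅)
  have hA : 0 ≤ A := (abs_nonneg _).trans (hc (Classical.arbitrary ι))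
  refine NormedSpace.norm_le_dual_bound ℝ _ (by positivity) fun φ => ?_
  have hφ : ∀ G : Finset ι, |∑ j ∈ G, φ (v j)| ≤ ‖φ‖ * M := fun G => by
    rw [← map_sum, ← Real.norm_eq_abs]
    exact (φ.le_opNorm _).trans (by gcongr; exact h G)
  calc ‖φ (∑ j ∈ F, c j • v j)‖ = |∑ j ∈ F, c j * φ (v j)| := by simp [map_sum]
    _ ≤ ∑ j ∈ F, |c j * φ (v j)| := Finset.abs_sum_le_sum_abs _ _
    _ ≤ ∑ j ∈ F, A * |φ (v j)| := Finset.sum_le_sum fun j _ => by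
        rw [abs_mul]; gcongr; exact hc j
    _ = A * ∑ j ∈ F, |φ (v j)| := by rw [Finset.mul_sum]
    _ ≤ A * (2 * (‖φ‖ * M)) := by gcongr; exact sum_abs_le_two_mul_of_abs_sum_le hφ F
    _ = 2 * A * M * ‖φ‖ := by ring

/-- An unconditional basis with continuous biorthogonal coordinate functionals, on whose
expansions bounded multipliers act boundedly. -/
structure UnconditionalSystem (X : Type*) [NormedAddCommGroup X] [NormedSpace ℝ X] where
  /-- The basis vectors. -/
  vec : ℕ → X
  /-- The coordinate functionals. -/
  coord : ℕ → X →L[ℝ] ℝ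
  /-- The unconditional constant. -/
  bound : ℝ
  bound_nonneg : 0 ≤ bound
  hasSum_coord : ∀ x, HasSum (fun j => coord j x • vec j) x
  coord_vec : ∀ i j, coord i (vec j) = if i = j then 1 else 0
  norm_sum_le : ∀ (c : ℕ → ℝ) (A : ℝ) (F : Finset ℕ) (x : X), (∀ j, |c j| ≤ A) →
    ‖∑ j ∈ F, (c j * coord j x) • vec j‖ ≤ bound * A * ‖x‖

/-- The coordinate functionals of an unconditional basis of a Banach space are continuous. -/
theorem HasUnconditionalSchauderBasis.nonempty_unconditionalSystem [CompleteSpace X]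
    (h : HasUnconditionalSchauderBasis X) : Nonempty (UnconditionalSystem X) := by
  classical
  obtain ⟨e, he⟩ := h
  choose a ha hau using he
  have hadd : ∀ x y, a (x + y) = a x + a y := fun x y =>
    (hau (x + y) _ (by simpa [add_smul] using (ha x).add (ha y))).symm
  have hsmul : ∀ (r : ℝ) x, a (r • x) = r • a x := fun r x =>
    (hau (r • x) _ (by simpa [mul_smul] using (ha x).const_smul r)).symm
  have hae : ∀ j, a (e j) = Pi.single j 1 := fun j => by
    refine (hau (e j) _ ?_).symm
    convert hasSum_single (f := fun i => (Pi.single j 1 : ℕ → ℝ) i • e i) j ?_ using 1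
    · simp
    · intro i hi
      simp [Pi.single_eq_of_ne hi]
  have he0 : ∀ j, e j ≠ 0 := fun j hj => by
    have h0 : a 0 = 0 := (hau 0 0 (by simp)).symm
    have := congrFun (hae j) j
    simp [hj, h0] at this
  choose M hM using fun x => exists_norm_finset_sum_le_of_summable (ha x).summable
  let _ : TopologicalSpace (Finset ℕ) := ⊥
  have : DiscreteTopology (Finset ℕ) := ⟨rfl⟩
  let T : X →ₗ[ℝ] BoundedContinuousFunction (Finset ℕ) X :=
    { toFun := fun x => BoundedContinuousFunction.ofNormedAddCommGroupDiscrete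
        (fun F => ∑ j ∈ F, a x j • e j) (M x) (hM x)
      map_add' := fun x y => by
        ext F
        simp [hadd, add_smul, Finset.sum_add_distrib]
      map_smul' := fun r x => by
        ext F
        simp [hsmul, mul_smul, Finset.smul_sum] }
  have hT : ∀ x F, T x F = ∑ j ∈ F, a x j • e j := fun x F => rfl
  have hcont : Continuous T := by
    refine T.continuous_of_seq_closed_graph fun u x y hu hy => ?_
    have hyF : ∀ F, Tendsto (fun n => ∑ j ∈ F, a (u n) j • e j) atTop (𝓝 (y F)) := fun F =>
      ((continuous_eval_const F).tendsto y).comp hy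
    have hb : ∀ j, ∃ b : ℝ, b • e j = y {j} := fun j => by
      have hcl : IsClosed (Submodule.span ℝ {e j} : Set X) :=
        Submodule.closed_of_finiteDimensional _
      refine Submodule.mem_span_singleton.1 (hcl.mem_of_tendsto (hyF {j}) (.of_forall fun n => ?_))
      simpa using Submodule.smul_mem _ _ (Submodule.mem_span_singleton_self (e j))
    choose b hb using hb
    have hyb : ∀ F, y F = ∑ j ∈ F, b j • e j := fun F => by
      refine tendsto_nhds_unique (hyF F) (tendsto_finsetSum F fun j _ => ?_)
      rw [hb]
      simpa using hyF {j}
    have hsum : HasSum (fun j => b j • e j) x := by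
      refine Metric.tendsto_nhds.2 fun ε hε => ?_
      obtain ⟨n, hn1, hn2⟩ := ((Metric.tendsto_nhds.1 hu (ε / 3) (by positivity)).and
        (Metric.tendsto_nhds.1 hy (ε / 3) (by positivity))).exists
      filter_upwards [Metric.tendsto_nhds.1 (ha (u n)) (ε / 3) (by positivity)] with F hF
      rw [← hyb]
      have h1 : dist (T (u n) F) (y F) < ε / 3 :=
        (BoundedContinuousFunction.dist_coe_le_dist F).trans_lt hn2
      have h2 : dist (T (u n) F) (u n) < ε / 3 := hF
      calc dist (y F) x ≤ dist (y F) (T (u n) F) + dist (T (u n) F) (u n) + dist (u n) x :=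
            dist_triangle4 _ _ _ _
        _ < ε := by rw [dist_comm (y F)]; linarith
    ext F
    rw [hyb, hT, hau x b hsum]
  let T' : X →L[ℝ] BoundedContinuousFunction (Finset ℕ) X := ⟨T, hcont⟩
  have hbound : ∀ x F, ‖∑ j ∈ F, a x j • e j‖ ≤ ‖T'‖ * ‖x‖ := fun x F =>
    ((T' x).norm_coe_le_norm F).trans (T'.le_opNorm x)
  let α : ℕ → X →L[ℝ] ℝ := fun j => LinearMap.mkContinuous
    { toFun := fun x => a x j
      map_add' := fun x y => congrFun (hadd x y) j
      map_smul' := fun r x => congrFun (hsmul r x) j } (‖T'‖ / ‖e j‖) fun x => by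
        have := hbound x {j}
        rw [Finset.sum_singleton, norm_smul] at this
        rw [div_mul_eq_mul_div, le_div_iff₀ (norm_pos_iff.2 (he0 j))]
        exact this
  have hα : ∀ j x, α j x = a x j := fun _ _ => rfl
  refine ⟨⟨e, α, 2 * ‖T'‖, by positivity, ha, fun i j => ?_, fun c A F x hc => ?_⟩⟩
  · rw [hα, hae, Pi.single_apply]
  · simp only [mul_smul]
    calc _ ≤ 2 * A * (‖T'‖ * ‖x‖) := norm_sum_smul_le_of_norm_sum_le (hbound x) hc F
      _ = _ := by ring

end Basis

section Mollify

variable {X Z E E' : Type*} [NormedAddCommGroup X] [NormedSpace ℝ X]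
  [NormedAddCommGroup Z] [NormedSpace ℝ Z]
  [NormedAddCommGroup E] [NormedSpace ℝ E] [FiniteDimensional ℝ E] [MeasureSpace E]

/-- The average of `h` against a smooth bump along the range of `A : E →L[ℝ] X`. -/
noncomputable def mollify (A : E →L[ℝ] X) (φ : ContDiffBump (0 : E)) (h : X → Z) (x : X) : Z :=
  ∫ t, φ.normed volume t • h (x - A t)

theorem mollify_add_eq_convolution (A : E →L[ℝ] X) (φ : ContDiffBump (0 : E)) (h : X → Z)
    (x : X) (y : E) : mollify A φ h (x + A y) =
      convolution (φ.normed volume) (fun z => h (x + A z)) (ContinuousLinearMap.lsmul ℝ ℝ)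
        volume y := by
  simp [mollify, convolution_def, add_sub_assoc]

variable [BorelSpace E] [(volume : Measure E).IsAddHaarMeasure]
  [NormedAddCommGroup E'] [NormedSpace ℝ E'] [FiniteDimensional ℝ E'] [MeasureSpace E']
  [BorelSpace E'] [(volume : Measure E').IsAddHaarMeasure]

theorem contDiff_mollify_comp (A : E →L[ℝ] X) (φ : ContDiffBump (0 : E)) {h : X → Z}
    (hh : Continuous h) (n : ℕ∞) : ContDiff ℝ n fun y => mollify A φ h (A y) := by
  have := φ.hasCompactSupport_normed (μ := (volume : Measure E)) |>.contDiff_convolution_left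
    (μ := volume) (ContinuousLinearMap.lsmul ℝ ℝ) (n := n) φ.contDiff_normed
    (g := fun z => h (0 + A z)) (Continuous.locallyIntegrable (by fun_prop))
  convert this using 2 with y
  rw [← mollify_add_eq_convolution, zero_add]

theorem integrable_mollify (A : E →L[ℝ] X) (φ : ContDiffBump (0 : E)) {h : X → Z}
    (hh : Continuous h) (x : X) : Integrable fun t => φ.normed volume t • h (x - A t) := by
  refine Continuous.integrable_of_hasCompactSupport ?_
    (φ.hasCompactSupport_normed (μ := (volume : Measure E))).smul_right
  exact φ.continuous_normed.smul (by fun_prop)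

theorem dist_mollify_mollify_le (A : E →L[ℝ] X) (φ : ContDiffBump (0 : E)) {h k : X → Z}
    (hh : Continuous h) (hk : Continuous k) {x y : X} {d : ℝ}
    (hd : ∀ t, dist (h (x - A t)) (k (y - A t)) ≤ d) :
    dist (mollify A φ h x) (mollify A φ k y) ≤ d := by
  rw [dist_eq_norm, mollify, mollify, ← integral_sub (integrable_mollify A φ hh x)
    (integrable_mollify A φ hk y)]
  calc _ ≤ ∫ t, φ.normed volume t * d := by
        refine norm_integral_le_of_norm_le (φ.integrable_normed.mul_const d) (.of_forall fun t => ?_)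
        rw [← smul_sub, norm_smul, Real.norm_of_nonneg (φ.nonneg_normed t), ← dist_eq_norm]
        exact mul_le_mul_of_nonneg_left (hd t) (φ.nonneg_normed t)
    _ = d := by rw [integral_mul_const, φ.integral_normed, one_mul]

theorem lipschitzWith_mollify (A : E →L[ℝ] X) (φ : ContDiffBump (0 : E)) {h : X → Z}
    {C : NNReal} (hh : LipschitzWith C h) : LipschitzWith C (mollify A φ h) :=
  .of_dist_le_mul fun x y => dist_mollify_mollify_le A φ hh.continuous hh.continuous fun t => by
    simpa using hh.dist_le_mul (x - A t) (y - A t)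

theorem dist_mollify_self_le [CompleteSpace Z] (A : E →L[ℝ] X) (φ : ContDiffBump (0 : E))
    {h : X → Z} {C : NNReal} (hh : LipschitzWith C h) (x : X) :
    dist (mollify A φ h x) (h x) ≤ C * (‖A‖ * φ.rOut) := by
  have h1 := mollify_add_eq_convolution A φ h x 0
  have := hh.continuous
  have h2 : dist (convolution (φ.normed volume) (fun z => h (x + A z))
      (ContinuousLinearMap.lsmul ℝ ℝ) volume 0) (h (x + A 0)) ≤ C * (‖A‖ * φ.rOut) := by
    refine φ.dist_normed_convolution_le (g := fun z => h (x + A z))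
      (Continuous.aestronglyMeasurable (by fun_prop)) fun z hz => ?_
    refine (hh.dist_le_mul _ _).trans ?_
    rw [map_zero, add_zero, dist_self_add_left]
    rw [mem_ball_zero_iff] at hz
    exact mul_le_mul_of_nonneg_left ((A.le_opNorm z).trans (by gcongr)) C.2
  rwa [← h1, map_zero, add_zero] at h2

theorem mollify_mollify_comm (A : E →L[ℝ] X) (φ : ContDiffBump (0 : E)) (B : E' →L[ℝ] X)
    (ψ : ContDiffBump (0 : E')) {h : X → Z} (hh : Continuous h) :
    mollify A φ (mollify B ψ h) = mollify B ψ (mollify A φ h) := by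
  ext x
  simp only [mollify, ← integral_smul]
  rw [integral_integral_swap_of_hasCompactSupport]
  · congr! 4 with s t
    rw [smul_comm, sub_right_comm]
  · have := φ.continuous_normed (μ := (volume : Measure E))
    have := ψ.continuous_normed (μ := (volume : Measure E'))
    simp only [Function.uncurry_def]
    fun_prop
  · refine HasCompactSupport.intro
      ((φ.hasCompactSupport_normed (μ := (volume : Measure E))).isCompact.prod
      (ψ.hasCompactSupport_normed (μ := (volume : Measure E'))).isCompact) ?_
    rintro ⟨t, s⟩ hts
    rw [Set.mem_prod, not_and_or] at hts
    rcases hts with h | h <;> simp [image_eq_zero_of_notMem_tsupport h]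

end Mollify

section Iterate

variable {X Z : Type*} [PseudoMetricSpace X] [MetricSpace Z] [CompleteSpace Z]

/-- Iterating operators that preserve `C`-Lipschitz maps and move them by summably small amounts
converges uniformly to a `C`-Lipschitz map. -/
theorem exists_lipschitzWith_limit {C : NNReal} {ε : ℝ} (T : ℕ → (X → Z) → X → Z)
    (hT : ∀ n h, LipschitzWith C h → LipschitzWith C (T n h))
    (hTd : ∀ n h, LipschitzWith C h → ∀ x, dist (T n h x) (h x) ≤ ε / 2 / 2 ^ n)
    {G : ℕ → X → Z} (hG0 : LipschitzWith C (G 0)) (hG : ∀ n, G (n + 1) = T n (G n)) :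
    (∀ n, LipschitzWith C (G n)) ∧
      ∃ g : X → Z, LipschitzWith C g ∧ ∀ n x, dist (G n x) (g x) ≤ ε / 2 ^ n := by
  have hL : ∀ n, LipschitzWith C (G n) := fun n => by
    induction n with
    | zero => exact hG0
    | succ n ih => rw [hG]; exact hT n _ ih
  have hd : ∀ x n, dist (G n x) (G (n + 1) x) ≤ ε / 2 / 2 ^ n := fun x n => by
    rw [hG, dist_comm]; exact hTd n _ (hL n) x
  choose g hg using fun x => cauchySeq_tendsto_of_complete (cauchySeq_of_le_geometric_two (hd x))
  refine ⟨hL, g, .of_dist_le_mul fun x y => ?_, fun n x =>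
    dist_le_of_le_geometric_two_of_tendsto (hd x) (hg x) n⟩
  exact le_of_tendsto ((hg x).dist (hg y)) (.of_forall fun n => (hL n).dist_le_mul x y)

end Iterate

/-- A Lipschitz map can be uniformly approximated by a Lipschitz map which is smooth along
the ranges of a given sequence of finite rank operators. -/
theorem LipschitzWith.exists_smooth_along {X Z : Type*} [NormedAddCommGroup X] [NormedSpace ℝ X]
    [NormedAddCommGroup Z] [NormedSpace ℝ Z] [CompleteSpace Z]
    (A : ∀ n : ℕ, (Fin n → ℝ) →L[ℝ] X) {f : X → Z} {C : NNReal} (hf : LipschitzWith C f)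
    {ε : ℝ} (hε : 0 < ε) :
    ∃ g : X → Z, LipschitzWith C g ∧ (∀ x, dist (f x) (g x) ≤ ε) ∧
      ∀ (n : ℕ) (p : ℕ∞), ContDiff ℝ p fun y => g (A n y) := by
  have hφ : ∀ n, ∃ φ : ContDiffBump (0 : Fin n → ℝ), C * (‖A n‖ * φ.rOut) ≤ ε / 2 / 2 ^ n := by
    intro n
    set r : ℝ := ε / 2 / 2 ^ n / (C * ‖A n‖ + 1) with hr
    have hr0 : 0 < r := by positivity
    refine ⟨⟨r / 2, r, by positivity, by linarith⟩, ?_⟩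
    change C * (‖A n‖ * r) ≤ _
    calc (C : ℝ) * (‖A n‖ * r) ≤ (C * ‖A n‖ + 1) * r := by nlinarith
      _ = _ := by rw [hr]; field_simp
  choose φ hφ using hφ
  set T : ℕ → (X → Z) → X → Z := fun n => mollify (A n) (φ n) with hTdef
  have hT : ∀ n h, LipschitzWith C h → LipschitzWith C (T n h) := fun n h hh => lipschitzWith_mollify _ _ hh
  have hTd : ∀ n h, LipschitzWith C h → ∀ x, dist (T n h x) (h x) ≤ ε / 2 / 2 ^ n :=
    fun n h hh x => (dist_mollify_self_le _ _ hh x).trans (hφ n)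
  let G : ℕ → X → Z := fun n => Nat.rec f (fun n h => T n h) n
  obtain ⟨hGL, g, hg, hGg⟩ := exists_lipschitzWith_limit T hT hTd (G := G) hf fun _ => rfl
  refine ⟨g, hg, fun x => (hGg 0 x).trans_eq (by simp), fun m p => ?_⟩
  let T' : ℕ → (X → Z) → X → Z := Function.update T m id
  let G' : ℕ → X → Z := fun n => Nat.rec f (fun n h => T' n h) n
  obtain ⟨hGL', g', hg', hGg'⟩ := exists_lipschitzWith_limit (C := C) (ε := ε) T'
    (fun n h hh => by
      rcases eq_or_ne n m with rfl | hn
      · simpa [T'] using hh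
      · simpa [T', hn] using hT n h hh)
    (fun n h hh x => by
      rcases eq_or_ne n m with rfl | hn
      · simpa [T'] using by positivity
      · simpa [T', hn] using hTd n h hh x) (G := G') hf fun _ => rfl
  have hle : ∀ n ≤ m, G n = G' n := fun n hn => by
    induction n with
    | zero => rfl
    | succ n ih =>
      change T n (G n) = T' n (G' n)
      rw [ih (by omega)]
      simp [T', show n ≠ m by omega]
  have hlt : ∀ n, m + 1 ≤ n → G n = T m (G' n) := fun n hn => by
    induction n, hn using Nat.le_induction with
    | base =>
      change T m (G m) = T m (T' m (G' m))
      rw [hle m le_rfl]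
      simp [T']
    | succ n hn ih =>
      change T n (G n) = T m (T' n (G' n))
      rw [ih]
      simp only [T', show n ≠ m by omega, ne_eq, not_false_eq_true, Function.update_of_ne]
      exact mollify_mollify_comm _ _ _ _ (hGL' n).continuous
  have hlim : Tendsto (fun n : ℕ => ε / 2 ^ n) atTop (𝓝 0) := by
    simpa [div_eq_mul_inv] using
      (tendsto_pow_atTop_nhds_zero_of_lt_one (r := (2 : ℝ)⁻¹) (by norm_num)
        (by norm_num)).const_mul ε
  have hgm : g = mollify (A m) (φ m) g' := by
    ext x
    have h1 : Tendsto (fun n => G n x) atTop (𝓝 (g x)) :=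
      tendsto_iff_dist_tendsto_zero.2
        (squeeze_zero (fun _ => dist_nonneg) (fun n => hGg n x) hlim)
    have h2 : Tendsto (fun n => T m (G' n) x) atTop (𝓝 (mollify (A m) (φ m) g' x)) :=
      tendsto_iff_dist_tendsto_zero.2 (squeeze_zero (fun _ => dist_nonneg)
        (fun n => dist_mollify_mollify_le _ _ (hGL' n).continuous hg'.continuous
          fun t => hGg' n _) hlim)
    exact tendsto_nhds_unique (h1.congr' (eventually_atTop.2 ⟨m + 1, fun n hn => by
      rw [hlt n hn]⟩)) h2
  rw [hgm]
  exact contDiff_mollify_comp _ _ hg'.continuous p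

/-- A smooth Lipschitz bump produces a smooth Lipschitz function which vanishes near the origin
and equals `1` away from a given ball. -/
theorem exists_smooth_lipschitz_cutoff {X : Type*} [NormedAddCommGroup X] [NormedSpace ℝ X]
    {p : ℕ∞} {b : X → ℝ} (hb : ContDiff ℝ p b) {C : NNReal} (hbC : LipschitzWith C b)
    (hbs : IsBounded (support b)) (hbn : (support b).Nonempty) {R : ℝ} (hR : 0 < R) :
    ∃ (θ : X → ℝ) (L : NNReal), ContDiff ℝ p θ ∧ LipschitzWith L θ ∧ (∀ x, 0 ≤ θ x) ∧
      (∀ x, θ x ≤ 1) ∧ (∃ r > 0, ∀ x, ‖x‖ < r → θ x = 0) ∧ ∀ x, R ≤ ‖x‖ → θ x = 1 := by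
  obtain ⟨x₀, hx₀⟩ := hbn
  obtain ⟨R₀, hR₀pos, hR₀⟩ := hbs.subset_ball_lt 0 x₀
  let φ : ContDiffBump (1 : ℝ) := ⟨1 / 4, 1 / 2, by norm_num, by norm_num⟩
  obtain ⟨Lφ, hLφ⟩ := (φ.contDiff (n := 1)).lipschitzWith_of_hasCompactSupport
    φ.hasCompactSupport (by simp)
  let u : X → ℝ := fun x => (b x₀)⁻¹ * b (x₀ + (R₀ / R) • x)
  have huc : ContDiff ℝ p u :=
    contDiff_const.mul (hb.comp (contDiff_const.add (contDiff_const.smul contDiff_id)))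
  have huL : LipschitzWith (‖(b x₀)⁻¹‖₊ * (C * ‖R₀ / R‖₊)) u := .of_dist_le_mul fun x y => by
    have := hbC.dist_le_mul (x₀ + (R₀ / R) • x) (x₀ + (R₀ / R) • y)
    rw [dist_add_left, dist_smul₀] at this
    simp only [u, dist_eq_norm, ← mul_sub, norm_mul] at this ⊢
    push_cast
    simp only [mul_assoc]
    gcongr
  have hu0 : u 0 = 1 := by simp [u, inv_mul_cancel₀ hx₀]
  refine ⟨fun x => 1 - φ (u x), Lφ * (‖(b x₀)⁻¹‖₊ * (C * ‖R₀ / R‖₊)), contDiff_const.sub (φ.contDiff.comp huc),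
    .of_dist_le_mul fun x y => ?_, fun x => sub_nonneg.2 φ.le_one,
    fun x => sub_le_self _ φ.nonneg, ?_, fun x hx => ?_⟩
  · rw [dist_sub_left]
    exact (hLφ.comp huL).dist_le_mul x y
  · have : ∀ᶠ x in 𝓝 (0 : X), φ (u x) = 1 := by
      exact (hu0 ▸ huc.continuous.tendsto 0).eventually φ.eventuallyEq_one
    obtain ⟨r, hr, h⟩ := Metric.eventually_nhds_iff.1 this
    exact ⟨r, hr, fun x hx => by simp [h (by simpa using hx : dist x 0 < r)]⟩
  · have h0 : b (x₀ + (R₀ / R) • x) = 0 := by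
      by_contra h
      have := hR₀ (mem_support.2 h)
      rw [Metric.mem_ball, dist_self_add_left, norm_smul, Real.norm_of_nonneg (by positivity)]
        at this
      have : R₀ / R * R ≤ R₀ / R * ‖x‖ := by gcongr
      rw [div_mul_cancel₀ _ hR.ne'] at this
      linarith
    have : φ (u x) = 0 := φ.zero_of_le_dist (by simp [u, h0, φ]; norm_num)
    simp [this]

namespace UnconditionalSystem

variable {X : Type*} [NormedAddCommGroup X] [NormedSpace ℝ X] (S : UnconditionalSystem X)

/-- The tail `x ↦ ∑_{j ≥ n} xⱼ eⱼ` of the expansion. -/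
noncomputable def tail (n : ℕ) : X →L[ℝ] X :=
  ContinuousLinearMap.id ℝ X - ∑ j ∈ Finset.range n, (S.coord j).smulRight (S.vec j)

theorem tail_apply (n : ℕ) (x : X) :
    S.tail n x = x - ∑ j ∈ Finset.range n, S.coord j x • S.vec j := by
  simp [tail]

theorem norm_tail_le (n : ℕ) (x : X) : ‖S.tail n x‖ ≤ (1 + S.bound) * ‖x‖ := by
  rw [tail_apply, add_mul, one_mul]
  refine (norm_sub_le _ _).trans (add_le_add le_rfl ?_)
  simpa using S.norm_sum_le (fun _ => 1) 1 (Finset.range n) x (by simp)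

theorem tendsto_tail (x : X) : Tendsto (fun n => S.tail n x) atTop (𝓝 0) := by
  simp only [tail_apply]
  simpa using (tendsto_const_nhds (x := x)).sub (S.hasSum_coord x).tendsto_sum_nat

theorem coord_tail {k j : ℕ} (h : k ≤ j) (x : X) : S.coord j (S.tail k x) = S.coord j x := by
  have : ∑ i ∈ Finset.range k, S.coord i x * (if j = i then 1 else 0) = 0 :=
    Finset.sum_eq_zero fun i hi => by
      rw [Finset.mem_range] at hi
      simp [show j ≠ i by omega]
  simp only [tail_apply, map_sub, map_sum, map_smul, S.coord_vec, smul_eq_mul, this, sub_zero]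

/-- Multipliers supported where the tails are small. -/
theorem norm_sum_le_of_tail_le {c : ℕ → ℝ} {A R : ℝ} (hR : 0 ≤ R) {x : X} (hc : ∀ j, |c j| ≤ A)
    (h : ∀ j, c j ≠ 0 → ‖S.tail j x‖ ≤ R) (F : Finset ℕ) :
    ‖∑ j ∈ F, (c j * S.coord j x) • S.vec j‖ ≤ S.bound * A * R := by
  classical
  have hA : 0 ≤ A := (abs_nonneg _).trans (hc 0)
  have hU := S.bound_nonneg
  by_cases hex : ∃ j, c j ≠ 0
  · have hk : ∀ j, c j * S.coord j x = c j * S.coord j (S.tail (Nat.find hex) x) := fun j => by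
      by_cases hj : c j = 0
      · simp [hj]
      · rw [S.coord_tail (Nat.find_min' hex hj)]
    simp only [hk]
    refine (S.norm_sum_le c A F _ hc).trans ?_
    gcongr
    exact h _ (Nat.find_spec hex)
  · push Not at hex
    simp only [hex, zero_mul, zero_smul, Finset.sum_const_zero, norm_zero]
    positivity

variable (θ : X → ℝ)

/-- Truncation of the expansion, where the cutoff `θ` decides, from the size of the tail, how much
of each coordinate is kept. -/
noncomputable def truncate (x : X) : X := ∑' j, (θ (S.tail j x) * S.coord j x) • S.vec j

variable {S θ}

theorem truncate_eq_sum {n : ℕ} {x : X} (h : ∀ j ≥ n, θ (S.tail j x) = 0) :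
    S.truncate θ x = ∑ j ∈ Finset.range n, (θ (S.tail j x) * S.coord j x) • S.vec j :=
  tsum_eq_sum fun j hj => by simp [h j (by simpa using hj)]

theorem exists_eventually_cutoff_tail_eq_zero {r : ℝ} (hr : 0 < r)
    (hθ : ∀ x, ‖x‖ < r → θ x = 0) (x : X) :
    ∃ n, ∀ᶠ y in 𝓝 x, ∀ j ≥ n, θ (S.tail j y) = 0 := by
  have hU := S.bound_nonneg
  obtain ⟨n, hn⟩ := Metric.tendsto_atTop.1 (S.tendsto_tail x) (r / 2) (by positivity)
  refine ⟨n, Metric.eventually_nhds_iff.2 ⟨r / 2 / (1 + S.bound), by positivity, fun y hy j hj =>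
    hθ _ ?_⟩⟩
  have h1 : ‖S.tail j x‖ < r / 2 := by simpa using hn j hj
  have h2 := S.norm_tail_le j (y - x)
  rw [map_sub] at h2
  rw [lt_div_iff₀ (by positivity), dist_eq_norm, mul_comm] at hy
  calc ‖S.tail j y‖ = ‖S.tail j x + (S.tail j y - S.tail j x)‖ := by congr 1; abel
    _ ≤ _ := norm_add_le _ _
    _ < r := by linarith

theorem exists_cutoff_tail_eq_zero {r : ℝ} (hr : 0 < r)
    (hθ : ∀ x, ‖x‖ < r → θ x = 0) (x : X) :
    ∃ n, ∀ j ≥ n, θ (S.tail j x) = 0 :=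
  let ⟨n, hn⟩ := exists_eventually_cutoff_tail_eq_zero (S := S) hr hθ x
  ⟨n, hn.self_of_nhds⟩

theorem dist_truncate_le {r R : ℝ} (hr : 0 < r) (hR : 0 < R) (hθ : ∀ x, ‖x‖ < r → θ x = 0)
    (hθR : ∀ x, R ≤ ‖x‖ → θ x = 1) (h0 : ∀ x, 0 ≤ θ x) (h1 : ∀ x, θ x ≤ 1) (x : X) :
    dist x (S.truncate θ x) ≤ (S.bound + 1) * R := by
  obtain ⟨n, hn⟩ := exists_cutoff_tail_eq_zero (S := S) hr hθ x
  obtain ⟨m, hm⟩ := Metric.tendsto_atTop.1 (S.tendsto_tail x) R hR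
  have hx : x = S.tail (max n m) x + ∑ j ∈ Finset.range (max n m), S.coord j x • S.vec j := by
    rw [tail_apply]; abel
  have hsub : x - S.truncate θ x = S.tail (max n m) x +
      ∑ j ∈ Finset.range (max n m), ((1 - θ (S.tail j x)) * S.coord j x) • S.vec j := by
    rw [truncate_eq_sum (n := max n m) fun j hj => hn j (le_of_max_le_left hj)]
    nth_rw 1 [hx]
    rw [add_sub_assoc, ← Finset.sum_sub_distrib]
    simp only [← sub_smul, sub_mul, one_mul]
  have hb := S.norm_sum_le_of_tail_le (c := fun j => 1 - θ (S.tail j x)) (A := 1) hR.le (x := x)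
    (fun j => abs_le.2 ⟨by linarith [h1 (S.tail j x)], by linarith [h0 (S.tail j x)]⟩)
    (fun j hj => le_of_not_ge fun h => hj (by simp [hθR _ h])) (Finset.range (max n m))
  have ht : ‖S.tail (max n m) x‖ < R := by simpa using hm _ (le_max_right n m)
  rw [dist_eq_norm, hsub]
  refine (norm_add_le _ _).trans ?_
  linarith

theorem exists_lipschitzWith_truncate {r R : ℝ} {L : NNReal} (hr : 0 < r) (hR : 0 < R)
    (hθ : ∀ x, ‖x‖ < r → θ x = 0) (hθR : ∀ x, R ≤ ‖x‖ → θ x = 1) (h0 : ∀ x, 0 ≤ θ x)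
    (h1 : ∀ x, θ x ≤ 1) (hL : LipschitzWith L θ) :
    ∃ C : NNReal, LipschitzWith C (S.truncate θ) := by
  classical
  have hU := S.bound_nonneg
  refine ⟨⟨2 * S.bound + 2 * (S.bound * (L * (1 + S.bound)) * R), by positivity⟩,
    .of_dist_le_mul fun x y => ?_⟩
  change _ ≤ (2 * S.bound + 2 * (S.bound * (L * (1 + S.bound)) * R)) * _
  obtain ⟨n, hn⟩ := exists_cutoff_tail_eq_zero (S := S) hr hθ x
  obtain ⟨m, hm⟩ := exists_cutoff_tail_eq_zero (S := S) hr hθ y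
  set F := Finset.range (max n m)
  set d : ℕ → ℝ := fun j => θ (S.tail j x) - θ (S.tail j y) with hd
  have hdL : ∀ j, |d j| ≤ L * (1 + S.bound) * dist x y := fun j => by
    rw [mul_assoc, dist_eq_norm]
    refine (hL.dist_le_mul (S.tail j x) (S.tail j y)).trans ?_
    rw [dist_eq_norm, ← map_sub]
    gcongr
    exact S.norm_tail_le j _
  have hd1 : ∀ j, |d j| ≤ 1 := fun j => abs_le.2
    ⟨by linarith [h0 (S.tail j x), h1 (S.tail j y)], by linarith [h1 (S.tail j x), h0 (S.tail j y)]⟩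
  let c₁ : ℕ → ℝ := fun j => if ‖S.tail j y‖ ≤ R then d j else 0
  let c₂ : ℕ → ℝ := fun j => if ‖S.tail j y‖ ≤ R then 0 else d j
  have hsub : S.truncate θ x - S.truncate θ y =
      ∑ j ∈ F, (θ (S.tail j x) * S.coord j (x - y)) • S.vec j +
      ∑ j ∈ F, (c₁ j * S.coord j y) • S.vec j + ∑ j ∈ F, (c₂ j * S.coord j x) • S.vec j -
      ∑ j ∈ F, (c₂ j * S.coord j (x - y)) • S.vec j := by
    rw [truncate_eq_sum (n := max n m) fun j hj => hn j (le_of_max_le_left hj),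
      truncate_eq_sum (n := max n m) fun j hj => hm j (le_of_max_le_right hj),
      ← Finset.sum_sub_distrib, ← Finset.sum_add_distrib, ← Finset.sum_add_distrib,
      ← Finset.sum_sub_distrib]
    refine Finset.sum_congr rfl fun j _ => ?_
    rw [← sub_smul, ← add_smul, ← add_smul, ← sub_smul, map_sub]
    congr 1
    by_cases h : ‖S.tail j y‖ ≤ R <;> simp only [c₁, c₂, h, if_true, if_false, hd] <;> ring
  have b₁ := S.norm_sum_le (fun j => θ (S.tail j x)) 1 F (x - y)
    fun j => by rw [abs_of_nonneg (h0 _)]; exact h1 _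
  have b₂ := S.norm_sum_le_of_tail_le (c := c₁) (A := L * (1 + S.bound) * dist x y) hR.le (x := y)
    (fun j => by
      by_cases h : ‖S.tail j y‖ ≤ R
      · simpa only [c₁, h, if_true] using hdL j
      · simp only [c₁, h, if_false, abs_zero]; positivity)
    (fun j hj => by
      by_contra h
      simp [c₁, h] at hj) F
  have b₃ := S.norm_sum_le_of_tail_le (c := c₂) (A := L * (1 + S.bound) * dist x y) hR.le (x := x)
    (fun j => by
      by_cases h : ‖S.tail j y‖ ≤ R
      · simp only [c₂, h, if_true, abs_zero]; positivity
      · simpa only [c₂, h, if_false] using hdL j)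
    (fun j hj => by
      by_contra h
      by_cases h' : ‖S.tail j y‖ ≤ R
      · simp [c₂, h'] at hj
      · simp [c₂, h', hd, hθR _ (le_of_not_ge h), hθR _ (le_of_not_ge h')] at hj) F
  have b₄ := S.norm_sum_le c₂ 1 F (x - y) fun j => by
      by_cases h : ‖S.tail j y‖ ≤ R
      · simp [c₂, h]
      · simpa only [c₂, h, if_false] using hd1 j
  rw [← dist_eq_norm] at b₁ b₄
  rw [dist_eq_norm, hsub]
  refine (norm_sub_le_of_le (norm_add₃_le.trans <| add_le_add_three b₁ b₂ b₃) b₄).trans ?_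
  linarith

/-- Maps that are smooth on the spans of the first basis vectors become smooth after
truncation. -/
theorem contDiff_comp_truncate {Z : Type*} [NormedAddCommGroup Z] [NormedSpace ℝ Z] {p : ℕ∞}
    {r : ℝ} (hr : 0 < r) (hθ : ∀ x, ‖x‖ < r → θ x = 0) (hθp : ContDiff ℝ p θ) {g : X → Z}
    (hg : ∀ n : ℕ, ContDiff ℝ p fun t : Fin n → ℝ => g (∑ i, t i • S.vec i)) :
    ContDiff ℝ p (g ∘ S.truncate θ) := by
  refine contDiff_iff_contDiffAt.2 fun x => ?_
  obtain ⟨n, hn⟩ := exists_eventually_cutoff_tail_eq_zero (S := S) hr hθ x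
  have hΨ : ContDiff ℝ p fun y => fun i : Fin n => θ (S.tail i y) * S.coord i y :=
    contDiff_pi.2 fun i => (hθp.comp (S.tail i).contDiff).mul (S.coord i).contDiff
  refine ((hg n).comp hΨ).contDiffAt.congr_of_eventuallyEq ?_
  filter_upwards [hn] with y hy
  simp only [Function.comp_apply, truncate_eq_sum hy]
  rw [Finset.sum_range]

/-- In the presence of a smooth Lipschitz bump, Lipschitz maps into Banach spaces are uniform
limits of smooth Lipschitz maps. -/
theorem exists_smooth_lipschitz_approx (S : UnconditionalSystem X) {Z : Type*}
    [NormedAddCommGroup Z] [NormedSpace ℝ Z] [CompleteSpace Z] {p : ℕ∞} {b : X → ℝ} (hb : ContDiff ℝ p b) {C : NNReal}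
    (hbC : LipschitzWith C b) (hbs : IsBounded (support b)) (hbn : (support b).Nonempty)
    {f : X → Z} {D : NNReal} (hf : LipschitzWith D f) {ε : ℝ} (hε : 0 < ε) :
    ∃ K : X → Z, ContDiff ℝ p K ∧ (∃ C : NNReal, LipschitzWith C K) ∧ ∀ x, ‖f x - K x‖ < ε := by
  have hU := S.bound_nonneg
  set R : ℝ := ε / 3 / ((D + 1) * (S.bound + 1)) with hRdef
  have hR : 0 < R := by positivity
  obtain ⟨θ, L, hθp, hθL, h0, h1, ⟨r, hr, hθr⟩, hθR⟩ :=
    exists_smooth_lipschitz_cutoff hb hbC hbs hbn hR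
  obtain ⟨g, hgD, hfg, hg⟩ := hf.exists_smooth_along
    (fun n => ∑ i : Fin n, (ContinuousLinearMap.proj (R := ℝ) (φ := fun _ : Fin n => ℝ) i).smulRight
      (S.vec i)) (ε := ε / 3) (by positivity)
  obtain ⟨M, hM⟩ := S.exists_lipschitzWith_truncate hr hR hθr hθR h0 h1 hθL
  refine ⟨g ∘ S.truncate θ, S.contDiff_comp_truncate hr hθr hθp fun n => ?_,
    ⟨_, hgD.comp hM⟩, fun x => ?_⟩
  · simpa using hg n p
  · rw [← dist_eq_norm]
    have h2 : dist (f x) (f (S.truncate θ x)) ≤ ε / 3 := calc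
      _ ≤ D * ((S.bound + 1) * R) := (hf.dist_le_mul _ _).trans
          (by gcongr; exact S.dist_truncate_le hr hR hθr hθR h0 h1 x)
      _ ≤ (D + 1) * ((S.bound + 1) * R) := by gcongr; linarith
      _ = ε / 3 := by rw [hRdef]; field_simp
    calc dist (f x) (g (S.truncate θ x)) ≤ _ := dist_triangle _ (f (S.truncate θ x)) _
      _ < ε := by linarith [hfg (S.truncate θ x)]

end UnconditionalSystem

/-- A smooth Lipschitz function at bounded distance from the norm produces a smooth Lipschitz
bump. -/
theorem exists_smooth_lipschitz_bump {X : Type*} [NormedAddCommGroup X] [NormedSpace ℝ X]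
    {p : ℕ∞} {K : X → ℝ} (hK : ContDiff ℝ p K) {C : NNReal} (hC : LipschitzWith C K)
    (h : ∀ x, |‖x‖ - K x| < 1) :
    ∃ b : X → ℝ, ContDiff ℝ p b ∧ (∃ C : NNReal, LipschitzWith C b) ∧
      IsBounded (closure (support b)) ∧ (support b).Nonempty := by
  let φ : ContDiffBump (0 : ℝ) := ⟨1, 2, by norm_num, by norm_num⟩
  obtain ⟨L, hL⟩ := (φ.contDiff (n := 1)).lipschitzWith_of_hasCompactSupport
    φ.hasCompactSupport (by simp)
  refine ⟨φ ∘ K, φ.contDiff.comp hK, ⟨_, hL.comp hC⟩,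
    ((Metric.isBounded_ball (x := 0) (r := 3)).subset fun x hx => ?_).closure, 0, ?_⟩
  · have h1 : K x ∈ support φ := hx
    rw [φ.support_eq, mem_ball_zero_iff, Real.norm_eq_abs, abs_lt] at h1
    have : K x < 2 := h1.2
    rw [mem_ball_zero_iff]
    linarith [(abs_lt.1 (h x)).2]
  · have h1 : K 0 ∈ support φ := by
      have h2 := h 0
      rw [φ.support_eq, mem_ball_zero_iff, Real.norm_eq_abs]
      rw [norm_zero, zero_sub, abs_neg] at h2
      exact h2.trans (by norm_num : (1 : ℝ) < 2)
    exact h1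

/-- A uniformly continuous function on a convex set is Lipschitz for large distances. -/
theorem UniformContinuous.exists_dist_le_of_convex {X : Type*} [NormedAddCommGroup X]
    [NormedSpace ℝ X] {Y : Set X} (hY : Convex ℝ Y) {f : Y → ℝ} (hf : UniformContinuous f)
    {ε : ℝ} (hε : 0 < ε) :
    ∃ M : NNReal, ∀ x y : Y, dist (f x) (f y) ≤ ε + M * dist x y := by
  obtain ⟨δ, hδ, h⟩ := Metric.uniformContinuous_iff.1 hf ε hε
  refine ⟨⟨ε / (δ / 2), by positivity⟩, fun x y => ?_⟩
  change _ ≤ ε + ε / (δ / 2) * _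
  set N : ℕ := ⌊dist x y / (δ / 2)⌋₊ + 1 with hN
  have hN0 : (0 : ℝ) < N := by positivity
  have hNlt : dist x y / (δ / 2) < N := by rw [hN]; push_cast; exact Nat.lt_floor_add_one _
  have hNle : (N : ℝ) ≤ dist x y / (δ / 2) + 1 := by
    rw [hN]; push_cast; gcongr; exact Nat.floor_le (by positivity)
  have hmem : ∀ k : ℕ, AffineMap.lineMap (x : X) (y : X) (min ((k : ℝ) / N) 1) ∈ Y := fun k =>
    hY.lineMap_mem x.2 y.2 ⟨by positivity, min_le_right _ _⟩
  let z : ℕ → Y := fun k => ⟨_, hmem k⟩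
  have hz0 : z 0 = x := by ext; simp [z]
  have hzN : z N = y := by ext; simp [z]
  have hstep : ∀ k, dist (f (z k)) (f (z (k + 1))) ≤ ε := fun k => by
    refine (h ?_).le
    rw [Subtype.dist_eq]
    simp only [z, dist_lineMap_lineMap]
    have h1 : dist (min ((k : ℝ) / N) 1) (min (((k + 1 : ℕ) : ℝ) / N) 1) ≤ 1 / N := by
      rw [Real.dist_eq]
      refine (abs_min_sub_min_le_max _ _ _ _).trans ?_
      push_cast
      rw [add_div, sub_add_cancel_left, abs_neg, abs_of_pos (by positivity)]
      simp
    calc _ ≤ 1 / N * dist (x : X) y := by gcongr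
      _ ≤ δ / 2 := by
        rw [div_mul_eq_mul_div, one_mul, div_le_iff₀ hN0]
        rw [div_lt_iff₀ (by positivity)] at hNlt
        exact (mul_comm (N : ℝ) _ ▸ hNlt).le
      _ < δ := by linarith
  have := dist_le_range_sum_of_dist_le (f := f ∘ z) N (d := fun _ => ε) fun {k} _ => hstep k
  simp only [Function.comp_apply, hz0, hzN, Finset.sum_const, Finset.card_range,
    nsmul_eq_mul] at this
  calc _ ≤ N * ε := this
    _ ≤ (dist x y / (δ / 2) + 1) * ε := by gcongr
    _ = _ := by ring

/-- A function which is Lipschitz up to an additive error `ε` is within `ε` of a Lipschitz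
function. -/
theorem exists_lipschitzWith_dist_le {Y : Type*} [PseudoMetricSpace Y] {f : Y → ℝ} {ε : ℝ}
    {M : NNReal} (h : ∀ x y, dist (f x) (f y) ≤ ε + M * dist x y) :
    ∃ g : Y → ℝ, LipschitzWith M g ∧ ∀ x, dist (f x) (g x) ≤ ε := by
  have hlow : ∀ x y, f x - ε ≤ f y + M * dist x y := fun x y => by
    linarith [(abs_le.1 (Real.dist_eq (f x) (f y) ▸ h x y)).2]
  have hbdd : ∀ x, BddBelow (Set.range fun y => f y + M * dist x y) := fun x =>
    ⟨f x - ε, by rintro _ ⟨y, rfl⟩; exact hlow x y⟩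
  refine ⟨fun x => ⨅ y, (f y + M * dist x y), .of_le_add_mul _ fun x x' => ?_, fun x => ?_⟩
  · have : Nonempty Y := ⟨x⟩
    rw [← sub_le_iff_le_add]
    refine le_ciInf fun y => ?_
    rw [sub_le_iff_le_add]
    refine (ciInf_le (hbdd x) y).trans ?_
    have := mul_le_mul_of_nonneg_left (dist_triangle x x' y) M.2
    change (M : ℝ) * _ ≤ M * _ at this
    linarith
  · have : Nonempty Y := ⟨x⟩
    have h1 : (⨅ y, (f y + M * dist x y)) ≤ f x := (ciInf_le (hbdd x) x).trans_eq (by simp)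
    have h2 : f x - ε ≤ ⨅ y, (f y + M * dist x y) := le_ciInf (hlow x)
    rw [Real.dist_eq, abs_of_nonneg (by linarith)]
    linarith

/-- Corollary: for a Banach space `X` with unconditional basis, the existence of a
Lipschitz `C^p`-smooth bump is equivalent to each of the three approximation properties. -/
theorem lipschitz_smooth_bump_tfae
    {X : Type*} [NormedAddCommGroup X] [NormedSpace ℝ X] [CompleteSpace X]
    (p : ℕ∞) (hp : 1 ≤ p)
    (hbasis : HasUnconditionalSchauderBasis X) :
    List.TFAE
      [ -- (1) X admits a Lipschitz, C^p-smooth bump function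
        (∃ b : X → ℝ, ContDiff ℝ p b ∧ (∃ C : NNReal, LipschitzWith C b) ∧
          IsBounded (closure (support b)) ∧ (support b).Nonempty),
        -- (2) uniform approximation of uniformly continuous functions on convex subsets
        (∀ (Y : Set X), Convex ℝ Y → ∀ (f : Y → ℝ), UniformContinuous f →
          ∀ ε : ℝ, 0 < ε →
            ∃ K : X → ℝ, ContDiff ℝ p K ∧ (∃ C : NNReal, LipschitzWith C K) ∧
              ∀ y : Y, |f y - K (y : X)| < ε),
        -- (3) uniform approximation of Lipschitz functions on arbitrary subsets
        (∀ (Y : Set X) (f : Y → ℝ), (∃ C : NNReal, LipschitzWith C f) →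
          ∀ ε : ℝ, 0 < ε →
            ∃ K : X → ℝ, ContDiff ℝ p K ∧ (∃ C : NNReal, LipschitzWith C K) ∧
              ∀ y : Y, |f y - K (y : X)| < ε),
        -- (4) uniform approximation of Lipschitz maps into any Banach space
        (∀ (Z : Type u) (_ : NormedAddCommGroup Z) (_ : NormedSpace ℝ Z) (_ : CompleteSpace Z),
          ∀ (f : X → Z), (∃ C : NNReal, LipschitzWith C f) →
            ∀ ε : ℝ, 0 < ε →
              ∃ K : X → Z, ContDiff ℝ p K ∧ (∃ C : NNReal, LipschitzWith C K) ∧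
                ∀ x : X, ‖f x - K x‖ < ε) ] := by
  tfae_have 1 → 4 := by
    rintro ⟨b, hb, ⟨C, hC⟩, hbs, hbn⟩ Z _ _ _ f ⟨D, hf⟩ ε hε
    obtain ⟨S⟩ := hbasis.nonempty_unconditionalSystem
    exact S.exists_smooth_lipschitz_approx hb hC (hbs.subset subset_closure) hbn hf hε
  tfae_have 4 → 3 := by
    classical
    rintro h Y f ⟨C, hf⟩ ε hε
    obtain ⟨g, hg, hgf⟩ := LipschitzOnWith.extend_real (K := C) (s := Y)
      (f := fun x => if hx : x ∈ Y then f ⟨x, hx⟩ else 0) <| .of_dist_le_mul fun x hx y hy => by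
        simpa [hx, hy, Subtype.dist_eq] using hf.dist_le_mul ⟨x, hx⟩ ⟨y, hy⟩
    let Φ : ULift ℝ ≃L[ℝ] ℝ := ContinuousLinearEquiv.ulift
    obtain ⟨K, hK, ⟨D, hD⟩, hKg⟩ := h (ULift ℝ) inferInstance inferInstance inferInstance
      (fun x => ⟨g x⟩) ⟨C, .of_dist_le_mul hg.dist_le_mul⟩ ε hε
    refine ⟨fun x => (K x).down, Φ.contDiff.comp hK, ⟨D, .of_dist_le_mul hD.dist_le_mul⟩,
      fun y => ?_⟩
    have := hgf y.2
    simp only [y.2, dif_pos] at this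
    rw [this]
    exact hKg y
  tfae_have 3 → 2 := by
    intro h Y hY f hf ε hε
    obtain ⟨M, hM⟩ := hf.exists_dist_le_of_convex hY (half_pos hε)
    obtain ⟨g, hg, hfg⟩ := exists_lipschitzWith_dist_le hM
    obtain ⟨K, hK, hKL, hKg⟩ := h Y g ⟨M, hg⟩ (ε / 2) (half_pos hε)
    refine ⟨K, hK, hKL, fun y => ?_⟩
    have h1 := hfg y
    rw [Real.dist_eq] at h1
    linarith [abs_sub_le (f y) (g y) (K y), hKg y]
  tfae_have 2 → 1 := by
    intro h
    obtain ⟨K, hK, ⟨C, hC⟩, hKn⟩ := h Set.univ convex_univ (fun x => ‖(x : X)‖)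
      (uniformContinuous_norm.comp uniformContinuous_subtype_val) 1 one_pos
    exact exists_smooth_lipschitz_bump hK hC fun x => hKn ⟨x, trivial⟩
  tfae_finish
end

section
/- Let X be a separable Banach space, let F : X → ℝ be η-Lipschitz, and let ε > 0. Then there exists a function g : X → ℝ such that: g is η-Lipschitz; |g(x) − F(x)| < ε for all x ∈ X; and g is uniformly Gâteaux differentiable, i.e., g is Gâteaux differentiable and for each fixed h ∈ X, (g(x + th) − g(x))/t → D_h g(x) as t → 0 uniformly in x ∈ X. -/
open Filter Topology

namespace UniformGateaux

variable {X : Type*} [NormedAddCommGroup X]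

/-- `g` is `η`-Lipschitz, with a real constant. -/
def IsLip (η : ℝ) (g : X → ℝ) : Prop :=
  ∀ x x' : X, |g x - g x'| ≤ η * ‖x - x'‖

theorem IsLip.continuous {η : ℝ} {g : X → ℝ} (hg : IsLip η g) : Continuous g := by
  refine (LipschitzWith.of_dist_le_mul (K := η.toNNReal) fun x y => ?_).continuous
  rw [Real.dist_eq, dist_eq_norm]
  exact (hg x y).trans
    (mul_le_mul_of_nonneg_right (Real.le_coe_toNNReal η) (norm_nonneg _))

variable [NormedSpace ℝ X]

/-- The difference quotient of `g` at `x` in direction `h`. -/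
noncomputable def quot (g : X → ℝ) (h : X) (t : ℝ) (x : X) : ℝ :=
  (g (x + t • h) - g x) / t

/-- The difference quotients in direction `h` converge to `D`, uniformly on `X`. -/
def HasUnifDirDeriv (g : X → ℝ) (h : X) (D : X → ℝ) : Prop :=
  ∀ δ : ℝ, 0 < δ → ∃ τ : ℝ, 0 < τ ∧ ∀ x : X, ∀ t : ℝ, t ≠ 0 → |t| < τ →
    |quot g h t x - D x| < δ

/-- The difference quotients in direction `h` are uniformly Cauchy on `X`. -/
def UnifCauchyDir (g : X → ℝ) (h : X) : Prop :=
  ∀ δ : ℝ, 0 < δ → ∃ τ : ℝ, 0 < τ ∧ ∀ x : X, ∀ s t : ℝ, s ≠ 0 → t ≠ 0 → |s| < τ → |t| < τ →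
    |quot g h s x - quot g h t x| < δ

/-- The difference quotients in direction `h` are uniformly Cauchy, with linear rate `C`. -/
def LinCauchyDir (C : ℝ) (g : X → ℝ) (h : X) : Prop :=
  ∀ x : X, ∀ s t : ℝ, s ≠ 0 → t ≠ 0 → |quot g h s x - quot g h t x| ≤ C * (|s| + |t|)

/-- The average of `g` over the segment from `x` to `x + v`. -/
noncomputable def segAvg (v : X) (g : X → ℝ) (x : X) : ℝ :=
  ∫ s in (0 : ℝ)..1, g (x + s • v)

section Derivative

variable {η C : ℝ} {g : X → ℝ} {h a b : X} {D Da Db : X → ℝ}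

theorem HasUnifDirDeriv.tendsto (H : HasUnifDirDeriv g h D) (x : X) :
    Tendsto (fun t => quot g h t x) (𝓝[≠] 0) (𝓝 (D x)) := by
  rw [Metric.tendsto_nhdsWithin_nhds]
  intro δ hδ
  obtain ⟨τ, hτ, H⟩ := H δ hδ
  refine ⟨τ, hτ, fun {t} ht htτ => ?_⟩
  rw [Real.dist_eq] at htτ ⊢
  exact H x t ht (by simpa using htτ)

theorem HasUnifDirDeriv.unique (H : HasUnifDirDeriv g h Da) (H' : HasUnifDirDeriv g h Db)
    (x : X) : Da x = Db x :=
  tendsto_nhds_unique (H.tendsto x) (H'.tendsto x)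

theorem HasUnifDirDeriv.unifCauchyDir (H : HasUnifDirDeriv g h D) : UnifCauchyDir g h := by
  intro δ hδ
  obtain ⟨τ, hτ, H⟩ := H (δ / 2) (by positivity)
  refine ⟨τ, hτ, fun x s t hs ht hsτ htτ => ?_⟩
  have h1 := H x s hs hsτ
  have h2 := H x t ht htτ
  rw [abs_lt] at *
  constructor <;> linarith

theorem UnifCauchyDir.exists_hasUnifDirDeriv (H : UnifCauchyDir g h) :
    ∃ D, HasUnifDirDeriv g h D := by
  have key : ∀ x, ∃ L, Tendsto (fun t => quot g h t x) (𝓝[≠] 0) (𝓝 L) := by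
    intro x
    apply cauchy_map_iff_exists_tendsto.1
    rw [Metric.cauchy_iff]
    refine ⟨inferInstance, fun δ hδ => ?_⟩
    obtain ⟨τ, hτ, H⟩ := H δ hδ
    refine ⟨(fun t => quot g h t x) '' {t | t ≠ 0 ∧ |t| < τ}, image_mem_map ?_, ?_⟩
    · rw [Metric.mem_nhdsWithin_iff]
      refine ⟨τ, hτ, fun t ht => ⟨ht.2, ?_⟩⟩
      simpa using ht.1
    · rintro _ ⟨s, hs, rfl⟩ _ ⟨t, ht, rfl⟩
      exact H x s t hs.1 ht.1 hs.2 ht.2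
  choose D hD using key
  refine ⟨D, fun δ hδ => ?_⟩
  obtain ⟨τ, hτ, H⟩ := H (δ / 2) (by positivity)
  refine ⟨τ, hτ, fun x t ht htτ => ?_⟩
  refine lt_of_le_of_lt (le_of_tendsto (((hD x).const_sub (quot g h t x)).abs) ?_)
    (half_lt_self hδ)
  rw [eventually_nhdsWithin_iff]
  filter_upwards [Metric.ball_mem_nhds (0 : ℝ) hτ] with s hs hs0
  exact (H x t s ht hs0 htτ (by simpa using hs)).le

theorem LinCauchyDir.unifCauchyDir (H : LinCauchyDir C g h) : UnifCauchyDir g h := by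
  intro δ hδ
  have hC : (0 : ℝ) < 2 * (|C| + 1) := by positivity
  refine ⟨δ / (2 * (|C| + 1)), by positivity, fun x s t hs ht hsτ htτ => ?_⟩
  rw [lt_div_iff₀ hC] at hsτ htτ
  have h1 : C * (|s| + |t|) ≤ |C| * (|s| + |t|) :=
    mul_le_mul_of_nonneg_right (le_abs_self C) (by positivity)
  have h2 := H x s t hs ht
  have := abs_pos.2 hs
  have := abs_pos.2 ht
  nlinarith

theorem IsLip.abs_quot_le (hg : IsLip η g) (h : X) {t : ℝ} (ht : t ≠ 0) (x : X) :
    |quot g h t x| ≤ η * ‖h‖ := by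
  rw [quot, abs_div, div_le_iff₀ (abs_pos.2 ht)]
  refine (hg _ _).trans_eq ?_
  rw [add_sub_cancel_left, norm_smul, Real.norm_eq_abs]
  ring

theorem IsLip.abs_quot_sub_le (hg : IsLip η g) (a b : X) {t : ℝ} (ht : t ≠ 0) (x : X) :
    |quot g a t x - quot g b t x| ≤ η * ‖a - b‖ := by
  rw [quot, quot, ← sub_div, abs_div, div_le_iff₀ (abs_pos.2 ht), sub_sub_sub_cancel_right]
  refine (hg _ _).trans_eq ?_
  rw [add_sub_add_left_eq_sub, ← smul_sub, norm_smul, Real.norm_eq_abs]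
  ring

theorem IsLip.abs_quot_shift_le (hg : IsLip η g) (h : X) {s : ℝ} (hs : s ≠ 0) (x y : X) :
    |quot g h s x - quot g h s y| ≤ 2 * η * ‖x - y‖ / |s| := by
  rw [quot, quot, ← sub_div, abs_div, div_le_div_iff_of_pos_right (abs_pos.2 hs)]
  have h1 := hg (x + s • h) (y + s • h)
  have h2 := hg x y
  rw [add_sub_add_right_eq_sub] at h1
  rw [abs_le] at *
  constructor <;> linarith

theorem UnifCauchyDir.of_dense (hη : 0 ≤ η) (hg : IsLip η g) {S : Set X} (hS : Dense S)
    (H : ∀ a ∈ S, UnifCauchyDir g a) (h : X) : UnifCauchyDir g h := by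
  intro δ hδ
  obtain ⟨a, haS, ha⟩ := hS.exists_dist_lt h (ε := δ / (3 * (η + 1))) (by positivity)
  obtain ⟨τ, hτ, H⟩ := H a haS (δ / 3) (by positivity)
  refine ⟨τ, hτ, fun x s t hs ht hsτ htτ => ?_⟩
  have h1 := hg.abs_quot_sub_le h a hs x
  have h2 := hg.abs_quot_sub_le h a ht x
  have h3 := H x s t hs ht hsτ htτ
  rw [dist_eq_norm, lt_div_iff₀ (by positivity)] at ha
  have h4 : η * ‖h - a‖ ≤ δ / 3 := by nlinarith [norm_nonneg (h - a)]
  rw [abs_lt] at *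
  rw [abs_le] at *
  constructor <;> linarith

theorem HasUnifDirDeriv.smul (H : HasUnifDirDeriv g h D) (c : ℝ) :
    HasUnifDirDeriv g (c • h) (fun x => c * D x) := by
  intro δ hδ
  rcases eq_or_ne c 0 with rfl | hc
  · exact ⟨1, one_pos, fun x t _ _ => by simpa [quot] using hδ⟩
  have hc' := abs_pos.2 hc
  obtain ⟨τ, hτ, H⟩ := H (δ / |c|) (by positivity)
  refine ⟨τ / |c|, by positivity, fun x t ht htτ => ?_⟩
  have h1 := H x (t * c) (mul_ne_zero ht hc) (by rwa [abs_mul, ← lt_div_iff₀ hc'])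
  have h2 : quot g (c • h) t x = c * quot g h (t * c) x := by
    simp only [quot, smul_smul]
    field_simp
  rw [h2, ← mul_sub, abs_mul, mul_comm, ← lt_div_iff₀ hc']
  exact h1

theorem HasUnifDirDeriv.add (hη : 0 ≤ η) (hg : IsLip η g) (Ha : HasUnifDirDeriv g a Da)
    (Hb : HasUnifDirDeriv g b Db) :
    HasUnifDirDeriv g (a + b) (fun x => Da x + Db x) := by
  intro δ hδ
  obtain ⟨τ₁, hτ₁, Ha⟩ := Ha (δ / 4) (by positivity)
  obtain ⟨τ₂, hτ₂, Hc⟩ := Hb.unifCauchyDir (δ / 4) (by positivity)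
  obtain ⟨τ₃, hτ₃, Hb⟩ := Hb (δ / 4) (by positivity)
  obtain ⟨s, hs, hs'⟩ := exists_between (lt_min hτ₂ hτ₃)
  rw [lt_min_iff] at hs'
  have hsabs : |s| = s := abs_of_pos hs
  have hN : 0 < 2 * η * ‖a‖ + 1 := by positivity
  refine ⟨min (min τ₁ τ₂) (δ / 4 * s / (2 * η * ‖a‖ + 1)), by positivity,
    fun x t ht htτ => ?_⟩
  rw [lt_min_iff, lt_min_iff, lt_div_iff₀ hN] at htτ
  obtain ⟨⟨ht1, ht2⟩, ht3⟩ := htτ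
  have e : quot g (a + b) t x = quot g b t (x + t • a) + quot g a t x := by
    simp only [quot, smul_add, add_assoc]
    ring
  have h1 := Ha x t ht ht1
  have h2 := Hc (x + t • a) t s ht hs.ne' ht2 (by rw [hsabs]; exact hs'.1)
  have h3 := hg.abs_quot_shift_le b hs.ne' (x + t • a) x
  have h4 := Hb x s hs.ne' (by rw [hsabs]; exact hs'.2)
  have h5 : 2 * η * ‖x + t • a - x‖ / |s| ≤ δ / 4 := by
    rw [hsabs, div_le_iff₀ hs, add_sub_cancel_left, norm_smul, Real.norm_eq_abs]
    nlinarith [abs_nonneg t]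
  rw [e]
  rw [abs_lt] at *
  rw [abs_le] at h3
  constructor <;> linarith

/-- A Lipschitz function with uniformly Cauchy difference quotients in every direction is
uniformly Gâteaux differentiable. -/
theorem exists_gateaux_deriv (hη : 0 ≤ η) (hg : IsLip η g) (H : ∀ h, UnifCauchyDir g h) :
    ∃ g' : X → X →L[ℝ] ℝ, ∀ h, HasUnifDirDeriv g h (fun x => g' x h) := by
  choose D hD using fun h => (H h).exists_hasUnifDirDeriv
  refine ⟨fun x => LinearMap.mkContinuous
    { toFun := fun h => D h x
      map_add' := fun a b => (hD (a + b)).unique ((hD a).add hη hg (hD b)) x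
      map_smul' := fun c a => (hD (c • a)).unique ((hD a).smul c) x } η fun h => ?_, hD⟩
  refine le_of_tendsto ((hD h).tendsto x).norm ?_
  filter_upwards [self_mem_nhdsWithin] with t ht
  exact hg.abs_quot_le h ht x

end Derivative

section Averaging

variable {η C : ℝ} {g : X → ℝ} {h v : X}

theorem abs_integral_unit_le {f : ℝ → ℝ} {B : ℝ} (hf : ∀ s ∈ Set.Icc (0 : ℝ) 1, |f s| ≤ B) :
    |∫ s in (0 : ℝ)..1, f s| ≤ B := by
  have := intervalIntegral.norm_integral_le_of_norm_le_const (a := 0) (b := 1) (f := f) (C := B)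
    fun s hs => by
      rw [Set.uIoc_of_le zero_le_one] at hs
      exact hf s ⟨hs.1.le, hs.2⟩
  simpa using this

theorem intervalIntegrable_line (hg : Continuous g) (x v : X) (a b : ℝ) :
    IntervalIntegrable (fun s : ℝ => g (x + s • v)) MeasureTheory.volume a b :=
  Continuous.intervalIntegrable (by fun_prop) a b

theorem IsLip.segAvg (hg : IsLip η g) (v : X) : IsLip η (segAvg v g) := by
  intro x y
  have hc := hg.continuous
  rw [UniformGateaux.segAvg, UniformGateaux.segAvg, ← intervalIntegral.integral_sub
    (intervalIntegrable_line hc x v 0 1) (intervalIntegrable_line hc y v 0 1)]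
  refine abs_integral_unit_le fun s _ => (hg _ _).trans_eq ?_
  rw [add_sub_add_right_eq_sub]

theorem IsLip.abs_segAvg_sub_le (hη : 0 ≤ η) (hg : IsLip η g) (v x : X) :
    |UniformGateaux.segAvg v g x - g x| ≤ η * ‖v‖ := by
  have e : UniformGateaux.segAvg v g x - g x = ∫ s in (0 : ℝ)..1, (g (x + s • v) - g x) := by
    rw [intervalIntegral.integral_sub (intervalIntegrable_line hg.continuous x v 0 1)
      intervalIntegrable_const]
    simp [UniformGateaux.segAvg]
  rw [e]
  refine abs_integral_unit_le fun s hs => (hg _ _).trans ?_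
  rw [add_sub_cancel_left, norm_smul, Real.norm_of_nonneg hs.1]
  exact mul_le_mul_of_nonneg_left (mul_le_of_le_one_left (norm_nonneg _) hs.2) hη

theorem continuous_quot (hg : Continuous g) (h : X) (t : ℝ) : Continuous (quot g h t) := by
  unfold quot
  fun_prop

theorem quot_segAvg (hg : Continuous g) (v h : X) (t : ℝ) :
    quot (segAvg v g) h t = segAvg v (quot g h t) := by
  funext x
  have e : ∀ s : ℝ, x + s • v + t • h = x + t • h + s • v := fun s => by abel
  simp only [quot, segAvg, e]
  rw [intervalIntegral.integral_div, intervalIntegral.integral_sub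
    (intervalIntegrable_line hg _ v 0 1) (intervalIntegrable_line hg x v 0 1)]

theorem LinCauchyDir.segAvg (H : LinCauchyDir C g h) (hg : Continuous g) (v : X) :
    LinCauchyDir C (segAvg v g) h := by
  intro x s t hs ht
  rw [quot_segAvg hg, quot_segAvg hg, UniformGateaux.segAvg, UniformGateaux.segAvg,
    ← intervalIntegral.integral_sub
      (intervalIntegrable_line (continuous_quot hg h s) x v 0 1)
      (intervalIntegrable_line (continuous_quot hg h t) x v 0 1)]
  exact abs_integral_unit_le fun r _ => H _ s t hs ht

theorem quot_segAvg_self (hg : Continuous g) (v : X) {t : ℝ} (ht : t ≠ 0) (x : X) :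
    quot (segAvg v g) v t x
      = ∫ r in (0 : ℝ)..1, (g (x + v + (r * t) • v) - g (x + (r * t) • v)) := by
  have hi := intervalIntegrable_line hg x v
  have e1 : segAvg v g (x + t • v) = ∫ s in t..(1 + t), g (x + s • v) := by
    have := intervalIntegral.integral_comp_add_right (a := 0) (b := 1)
      (fun s : ℝ => g (x + s • v)) t
    rw [zero_add] at this
    rw [← this, segAvg]
    congr 1
    funext s
    rw [add_smul, add_assoc, add_comm (t • v)]
  have e2 : ∫ s in (1 : ℝ)..(1 + t), g (x + s • v) = ∫ s in (0 : ℝ)..t, g (x + v + s • v) := by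
    have := intervalIntegral.integral_comp_add_left (a := 0) (b := t)
      (fun s : ℝ => g (x + s • v)) 1
    rw [add_zero] at this
    rw [← this]
    congr 1
    funext s
    rw [add_smul, one_smul, add_assoc]
  have e3 := intervalIntegral.integral_add_adjacent_intervals (hi 0 1) (hi 1 (1 + t))
  have e4 := intervalIntegral.integral_add_adjacent_intervals (hi 0 t) (hi t (1 + t))
  have e5 := intervalIntegral.integral_comp_mul_right (a := 0) (b := 1)
    (fun s : ℝ => g (x + v + s • v) - g (x + s • v)) ht
  rw [zero_mul, one_mul, intervalIntegral.integral_sub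
    (intervalIntegrable_line hg (x + v) v 0 t) (hi 0 t)] at e5
  rw [e5, quot, e1, ← e2, smul_eq_mul, div_eq_inv_mul]
  congr 1
  rw [segAvg]
  linarith

theorem IsLip.linCauchyDir_segAvg_self (hη : 0 ≤ η) (hg : IsLip η g) (v : X) :
    LinCauchyDir (2 * η * ‖v‖) (UniformGateaux.segAvg v g) v := by
  have key : ∀ x : X, ∀ t : ℝ, t ≠ 0 →
      |quot (UniformGateaux.segAvg v g) v t x - (g (x + v) - g x)| ≤ 2 * η * ‖v‖ * |t| := by
    intro x t ht
    have hc := hg.continuous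
    have e : quot (UniformGateaux.segAvg v g) v t x - (g (x + v) - g x)
        = ∫ r in (0 : ℝ)..1,
          (g (x + v + (r * t) • v) - g (x + (r * t) • v) - (g (x + v) - g x)) := by
      rw [intervalIntegral.integral_sub (Continuous.intervalIntegrable (by fun_prop) 0 1)
        intervalIntegrable_const, ← quot_segAvg_self hc v ht]
      simp
    rw [e]
    refine abs_integral_unit_le fun r hr => ?_
    have h1 := hg (x + v + (r * t) • v) (x + v)
    have h2 := hg (x + (r * t) • v) x
    have h3 : η * ‖(r * t) • v‖ ≤ η * ‖v‖ * |t| := by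
      rw [norm_smul, Real.norm_eq_abs, abs_mul, abs_of_nonneg hr.1, mul_assoc η]
      refine mul_le_mul_of_nonneg_left ?_ hη
      nlinarith [mul_nonneg (abs_nonneg t) (norm_nonneg v), hr.2]
    rw [add_sub_cancel_left] at h1 h2
    rw [abs_le] at *
    constructor <;> linarith
  intro x s t hs ht
  have h1 := key x s hs
  have h2 := key x t ht
  rw [abs_le] at *
  constructor <;> linarith

/-- Successive averages of `F` over the segments given by `v`. -/
noncomputable def iterAvg (F : X → ℝ) (v : ℕ → X) : ℕ → X → ℝ
  | 0 => F
  | n + 1 => segAvg (v n) (iterAvg F v n)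

theorem IsLip.iterAvg {F : X → ℝ} (hF : IsLip η F) (v : ℕ → X) (n : ℕ) :
    IsLip η (iterAvg F v n) := by
  induction n with
  | zero => exact hF
  | succ n ih => exact ih.segAvg (v n)

theorem IsLip.linCauchyDir_iterAvg {F : X → ℝ} (hη : 0 ≤ η) (hF : IsLip η F) (v : ℕ → X)
    {n m : ℕ} (hnm : n + 1 ≤ m) :
    LinCauchyDir (2 * η * ‖v n‖) (UniformGateaux.iterAvg F v m) (v n) := by
  induction m, hnm using Nat.le_induction with
  | base => exact (hF.iterAvg v n).linCauchyDir_segAvg_self hη (v n)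
  | succ m _ ih => exact ih.segAvg (hF.iterAvg v m).continuous (v m)

theorem LinCauchyDir.of_tendsto {G : ℕ → X → ℝ} (hG : ∀ x, Tendsto (G · x) atTop (𝓝 (g x)))
    (H : ∀ᶠ n in atTop, LinCauchyDir C (G n) h) : LinCauchyDir C g h := by
  intro x s t hs ht
  have hq : ∀ r : ℝ, Tendsto (fun n => quot (G n) h r x) atTop (𝓝 (quot g h r x)) :=
    fun r => ((hG _).sub (hG _)).div_const r
  refine le_of_tendsto ((hq s).sub (hq t)).abs ?_
  filter_upwards [H] with n hn
  exact hn x s t hs ht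

end Averaging

end UniformGateaux

open UniformGateaux

/-- Every `η`-Lipschitz real function on a separable Banach space can be uniformly
approximated by `η`-Lipschitz, uniformly Gâteaux differentiable functions. -/
theorem lipschitz_approx_uniformly_gateaux
    {X : Type*} [NormedAddCommGroup X] [NormedSpace ℝ X] [CompleteSpace X]
    [TopologicalSpace.SeparableSpace X]
    (F : X → ℝ) (η : ℝ) (hη : 0 ≤ η)
    (hF : ∀ x x' : X, |F x - F x'| ≤ η * ‖x - x'‖)
    (ε : ℝ) (hε : 0 < ε) :
    ∃ g : X → ℝ,
      (∀ x x' : X, |g x - g x'| ≤ η * ‖x - x'‖) ∧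
      (∀ x : X, |g x - F x| < ε) ∧
      ∃ g' : X → X →L[ℝ] ℝ,
        ∀ h : X, ∀ δ : ℝ, 0 < δ → ∃ τ : ℝ, 0 < τ ∧
          ∀ x : X, ∀ t : ℝ, t ≠ 0 → |t| < τ →
            |(g (x + t • h) - g x) / t - g' x h| < δ := by
  have hF' : IsLip η F := hF
  let d : ℕ → X := TopologicalSpace.denseSeq X
  let c : ℕ → ℝ := fun n => ε / 2 / 2 / 2 ^ n / ((η + 1) * (1 + ‖d n‖))
  have hc : ∀ n, 0 < c n := fun n => by positivity
  let v : ℕ → X := fun n => c n • d n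
  have hv : ∀ n, η * ‖v n‖ ≤ ε / 2 / 2 / 2 ^ n := by
    intro n
    have hp : 0 < (η + 1) * (1 + ‖d n‖) := by positivity
    have hcn : c n * ((η + 1) * (1 + ‖d n‖)) = ε / 2 / 2 / 2 ^ n := div_mul_cancel₀ _ hp.ne'
    rw [← hcn, norm_smul, Real.norm_of_nonneg (hc n).le, mul_left_comm]
    exact mul_le_mul_of_nonneg_left (by nlinarith [norm_nonneg (d n)]) (hc n).le
  have hstep : ∀ x n, dist (iterAvg F v n x) (iterAvg F v (n + 1) x) ≤ ε / 2 / 2 / 2 ^ n := by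
    intro x n
    rw [dist_comm, Real.dist_eq]
    exact ((hF'.iterAvg v n).abs_segAvg_sub_le hη (v n) x).trans (hv n)
  choose g hg using fun x =>
    cauchySeq_tendsto_of_complete (cauchySeq_of_le_geometric_two (hstep x))
  have hgL : IsLip η g := fun x y =>
    le_of_tendsto ((hg x).sub (hg y)).abs (Eventually.of_forall fun n => hF'.iterAvg v n x y)
  have hgd : ∀ a ∈ Set.range d, UnifCauchyDir g a := by
    rintro _ ⟨n, rfl⟩
    have h1 : LinCauchyDir (2 * η * ‖v n‖) g (v n) := .of_tendsto hg <| by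
      filter_upwards [eventually_ge_atTop (n + 1)] with m hm
      exact hF'.linCauchyDir_iterAvg hη v hm
    obtain ⟨D, hD⟩ := h1.unifCauchyDir.exists_hasUnifDirDeriv
    have h2 := (hD.smul (c n)⁻¹).unifCauchyDir
    rwa [inv_smul_smul₀ (hc n).ne'] at h2
  refine ⟨g, hgL, fun x => ?_, exists_gateaux_deriv hη hgL
    (.of_dense hη hgL (TopologicalSpace.denseRange_denseSeq X) hgd)⟩
  rw [abs_sub_comm]
  exact (dist_le_of_le_geometric_two_of_tendsto₀ (hstep x) (hg x)).trans_lt (half_lt_self hε)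
end
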